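/- arXiv:1710.02727 — 5 statements merged into one kernel-verified Lean document; each statement's English description precedes it below -/
import Mathlib

section
/- Let C ≥ 1 and t ≥ 1 be integers and let G be a finite graph such that every non-empty induced subgraph of G contains a t-island of size at most C. Then for every t-list assignment L for G, the graph G admits an L-coloring with clustering C. In particular, χ^l_C(G) ≤ col_C(G) for every finite graph G. -/
open SimpleGraph

/-- `S` is a `t`-island in `G`: a nonempty set of vertices each of which has
fewer than `t` neighbors outside `S`. -/
def IsIsland {V : Type*} (G : SimpleGraph V) (t : ℕ) (S : Set V) : Prop :=
  S.Nonempty ∧ ∀ v ∈ S, ((G.neighborSet v) \ S).ncard < t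

/-- `H` is a minor of `G`: there is a model of `H` in `G`. -/
def IsMinorOf {W V : Type*} (H : SimpleGraph W) (G : SimpleGraph V) : Prop :=
  ∃ μ : W → Set V,
    (∀ w, (μ w).Nonempty) ∧
    (∀ w, (G.induce (μ w)).Connected) ∧
    (Pairwise fun w₁ w₂ => Disjoint (μ w₁) (μ w₂)) ∧
    (∀ ⦃w₁ w₂⦄, H.Adj w₁ w₂ → ∃ u ∈ μ w₁, ∃ v ∈ μ w₂, G.Adj u v)

/-- The graph `I_n + P_m`: a path on `m` vertices together with `n` additional
pairwise non-adjacent vertices, each adjacent to every vertex of the path. -/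
def IplusP (n m : ℕ) : SimpleGraph (Fin n ⊕ Fin m) :=
  SimpleGraph.fromRel (fun a b =>
    (∃ i j, a = Sum.inl i ∧ b = Sum.inr j) ∨
    (∃ i j : Fin m, a = Sum.inr i ∧ b = Sum.inr j ∧ (i : ℕ) + 1 = (j : ℕ)))

/-- `c` is a coloring of `G` with clustering `C`: every monochromatic connected
subgraph has at most `C` vertices. -/
def ClusteredColoring {V α : Type*} (G : SimpleGraph V) (C : ℕ) (c : V → α) : Prop :=
  ∀ S : Set V, (G.induce S).Connected → (∀ u ∈ S, ∀ v ∈ S, c u = c v) → S.ncard ≤ C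

/-- `G` has a tree decomposition of width at most `w`. -/
def HasTreewidthAtMost {V : Type*} (G : SimpleGraph V) (w : ℕ) : Prop :=
  ∃ (n : ℕ) (T : SimpleGraph (Fin n)) (β : Fin n → Set V), T.IsTree ∧
    (∀ ⦃u v⦄, G.Adj u v → ∃ x, u ∈ β x ∧ v ∈ β x) ∧
    (∀ v : V, (T.induce {x | v ∈ β x}).Connected) ∧
    (∀ x, (β x).ncard ≤ w + 1)

/-- A class of graphs, given for each `n` as a collection of graphs on `Fin n`. -/
def MemClass (𝒢 : ∀ n : ℕ, SimpleGraph (Fin n) → Prop) {V : Type*} (G : SimpleGraph V) : Prop :=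
  ∃ (n : ℕ) (G' : SimpleGraph (Fin n)), 𝒢 n G' ∧ Nonempty (G ≃g G')

/-- `𝒢` is a (proper) minor-closed class. -/
def MinorClosed (𝒢 : ∀ n : ℕ, SimpleGraph (Fin n) → Prop) : Prop :=
  (∃ (n : ℕ) (G : SimpleGraph (Fin n)), ¬ 𝒢 n G) ∧
  ∀ ⦃n k : ℕ⦄ (G : SimpleGraph (Fin n)) (H : SimpleGraph (Fin k)),
    𝒢 n G → IsMinorOf H G → 𝒢 k H

/-- `𝒢` is closed under taking subgraphs (up to isomorphism). -/
def SubgraphClosed (𝒢 : ∀ n : ℕ, SimpleGraph (Fin n) → Prop) : Prop :=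
  ∀ ⦃n k : ℕ⦄ (G : SimpleGraph (Fin n)) (H : SimpleGraph (Fin k)), 𝒢 n G →
    (∃ f : Fin k → Fin n, Function.Injective f ∧ ∀ ⦃a b⦄, H.Adj a b → G.Adj (f a) (f b)) →
    𝒢 k H

/-- The vertices that eventually become active in bootstrap `t`-percolation
starting from the active set `A`. -/
inductive PercolationActive {V : Type*} (G : SimpleGraph V) (t : ℕ) (A : Set V) : V → Prop
  | base (v : V) : v ∈ A → PercolationActive G t A v
  | step (v : V) (N : Finset V) : t ≤ N.card → (∀ u ∈ N, G.Adj v u) →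
      (∀ u ∈ N, PercolationActive G t A u) → PercolationActive G t A v

/-- The set `A` `t`-percolates in `G`. -/
def Percolates {V : Type*} (G : SimpleGraph V) (t : ℕ) (A : Set V) : Prop :=
  ∀ v, PercolationActive G t A v

/-- `G` contains `k` pairwise disjoint `t`-islands. -/
def HasDisjointIslands {V : Type*} (G : SimpleGraph V) (t k : ℕ) : Prop :=
  ∃ f : Fin k → Set V, (∀ i, IsIsland G t (f i)) ∧ Pairwise (Function.onFun Disjoint f)

/-- `f` is significantly sublinear: `∑ f(⌈(3/2)^i⌉)/(3/2)^i` is finite. -/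
def SignificantlySublinear (f : ℕ → ℕ) : Prop :=
  Summable (fun i : ℕ => (f ⌈((3:ℝ)/2)^i⌉₊ : ℝ) / ((3:ℝ)/2)^i)

/-- The class `𝒢` has `f`-separators. -/
def HasSeparators (f : ℕ → ℕ) (𝒢 : ∀ n : ℕ, SimpleGraph (Fin n) → Prop) : Prop :=
  ∀ (n : ℕ) (G : SimpleGraph (Fin n)), 𝒢 n G →
    ∃ L R : G.Subgraph, L ⊔ R = ⊤ ∧ (L.verts ∩ R.verts).ncard ≤ f n ∧
      3 * (L.verts \ R.verts).ncard ≤ 2 * n ∧ 3 * (R.verts \ L.verts).ncard ≤ 2 * n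

/-- The number of edges of `G` with at least one end in `A`. -/
noncomputable def edgesTouching {V : Type*} (G : SimpleGraph V) (A : Set V) : ℕ :=
  {e ∈ G.edgeSet | ∃ v ∈ A, v ∈ e}.ncard

/-- A connected set of vertices that meets both `I` and its complement spans an edge leaving `I`. -/
theorem exists_adj_of_connected_induce {V : Type*} {G : SimpleGraph V} {S I : Set V}
    (hS : (G.induce S).Connected) {u w : V} (hu : u ∈ S) (huI : u ∈ I) (hw : w ∈ S)
    (hwI : w ∉ I) : ∃ a ∈ S ∩ I, ∃ b ∈ S \ I, G.Adj a b := by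
  obtain ⟨p⟩ := hS.preconnected ⟨u, hu⟩ ⟨w, hw⟩
  obtain ⟨d, -, hd₁, hd₂⟩ := p.exists_boundary_dart (Subtype.val ⁻¹' I) huI hwI
  exact ⟨d.fst, ⟨d.fst.2, hd₁⟩, d.snd, ⟨d.snd.2, hd₂⟩, d.adj⟩

/-- A list with at least `t` colors contains one not used by `c` on a set of fewer than `t`
vertices. -/
theorem exists_mem_forall_ne_of_ncard_lt {V α : Type*} [Finite V] (c : V → α) {L : Finset α}
    {N : Set V} {t : ℕ} (hL : t ≤ L.card) (hN : N.ncard < t) : ∃ x ∈ L, ∀ w ∈ N, c w ≠ x := by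
  have hlt : (c '' N).ncard < (L : Set α).ncard := by
    rw [Set.ncard_coe_finset]
    exact (Set.ncard_image_le N.toFinite).trans_lt (hN.trans_le hL)
  obtain ⟨x, hxL, hxN⟩ := Set.exists_mem_notMem_of_ncard_lt_ncard hlt (N.toFinite.image c)
  exact ⟨x, hxL, fun w hw h => hxN ⟨w, hw, h⟩⟩

/-- If every nonempty set of vertices induces a subgraph with a `t`-island of size at most `C`,
then for each set `W` there is an `L`-coloring whose monochromatic connected sets inside `W` have
at most `C` vertices. -/
theorem exists_clustered_list_coloring_on {V α : Type*} [Finite V] (G : SimpleGraph V) {C t : ℕ}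
    (ht : 1 ≤ t)
    (hisl : ∀ W : Set V, W.Nonempty → ∃ S : Set V, S ⊆ W ∧ S.Nonempty ∧ S.ncard ≤ C ∧
      ∀ v ∈ S, ((G.neighborSet v ∩ W) \ S).ncard < t)
    (L : V → Finset α) (hL : ∀ v, t ≤ (L v).card) (W : Set V) :
    ∃ c : V → α, (∀ v, c v ∈ L v) ∧ ∀ S ⊆ W, (G.induce S).Connected →
      (∀ u ∈ S, ∀ v ∈ S, c u = c v) → S.ncard ≤ C := by
  classical
  induction W using WellFoundedLT.induction with
  | ind W ih =>
    rcases W.eq_empty_or_nonempty with rfl | hW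
    · have hne : ∀ v, ∃ x, x ∈ L v := fun v => Finset.card_pos.mp (ht.trans (hL v))
      choose c hc using hne
      refine ⟨c, hc, fun S hS _ _ => ?_⟩
      simp [Set.subset_empty_iff.mp hS]
    obtain ⟨I, hIW, hI, hIC, hIt⟩ := hisl W hW
    obtain ⟨c, hcL, hc⟩ := ih (W \ I) (hIW.sdiff_ssubset_of_nonempty hI)
    have hnew : ∀ v, ∃ x ∈ L v, v ∈ I → ∀ w ∈ (G.neighborSet v ∩ W) \ I, c w ≠ x := by
      intro v
      by_cases hv : v ∈ I
      · obtain ⟨x, hx, hne⟩ := exists_mem_forall_ne_of_ncard_lt c (hL v) (hIt v hv)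
        exact ⟨x, hx, fun _ => hne⟩
      · exact ⟨c v, hcL v, fun h => absurd h hv⟩
    choose d hdL hd using hnew
    refine ⟨fun v => if v ∈ I then d v else c v, fun v => ?_, fun S hSW hS hmono => ?_⟩
    · dsimp only
      split_ifs
      exacts [hdL v, hcL v]
    by_cases hSI : S ⊆ I
    · exact (Set.ncard_le_ncard hSI).trans hIC
    obtain ⟨w, hwS, hwI⟩ := Set.not_subset.mp hSI
    have hdisj : ∀ u ∈ S, u ∉ I := by
      intro u hu huI
      obtain ⟨a, ⟨haS, haI⟩, b, ⟨hbS, hbI⟩, hab⟩ :=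
        exists_adj_of_connected_induce hS hu huI hwS hwI
      have h := hmono b hbS a haS
      simp only [haI, hbI, if_true, if_false] at h
      exact hd a haI b ⟨⟨hab, hSW hbS⟩, hbI⟩ h
    refine hc S (fun u hu => ⟨hSW hu, hdisj u hu⟩) hS fun u hu v hv => ?_
    simpa [hdisj u hu, hdisj v hv] using hmono u hu v hv

/-- If every non-empty induced subgraph of `G` contains a `t`-island of size
at most `C`, then `G` admits an `L`-coloring with clustering `C` for every `t`-list
assignment `L`; in particular `χ^l_C(G) ≤ col_C(G)`. -/
theorem stmt0 {V : Type} [Fintype V] (G : SimpleGraph V) (C t : ℕ) (hC : 1 ≤ C) (ht : 1 ≤ t)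
    (hisl : ∀ W : Set V, W.Nonempty → ∃ S : Set V, S ⊆ W ∧ S.Nonempty ∧ S.ncard ≤ C ∧
      ∀ v ∈ S, ((G.neighborSet v ∩ W) \ S).ncard < t) :
    ∀ L : V → Finset ℕ, (∀ v, t ≤ (L v).card) →
      ∃ c : V → ℕ, (∀ v, c v ∈ L v) ∧ ClusteredColoring G C c := by
  intro L hL
  obtain ⟨c, hcL, hc⟩ := exists_clustered_list_coloring_on G ht hisl L hL Set.univ
  exact ⟨c, hcL, fun S => hc S (Set.subset_univ S)⟩
end

section
/- Let t ≥ 1 be an integer. For every integer C ≥ 1, there exists an integer m ≥ 1 such that every t-island in K_{t,m} has more than C vertices and every t-island in I_{t-1}+P_m has more than C vertices. -/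
open SimpleGraph

namespace IsIsland

variable {V : Type*} [Finite V] {G : SimpleGraph V} {t : ℕ} {S T : Set V} {v : V}

theorem ncard_lt_of_disjoint (h : IsIsland G t S) (hv : v ∈ S) (hT : T ⊆ G.neighborSet v)
    (hd : Disjoint T S) : T.ncard < t :=
  (Set.ncard_le_ncard (Set.subset_sdiff.2 ⟨hT, hd⟩)).trans_lt (h.2 v hv)

theorem ncard_lt_add (h : IsIsland G t S) (hv : v ∈ S) (hT : T ⊆ G.neighborSet v) :
    T.ncard < t + S.ncard := by
  have h1 : (T \ S).ncard < t :=
    h.ncard_lt_of_disjoint hv (Set.sdiff_subset.trans hT) Set.disjoint_sdiff_left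
  have h2 := Set.ncard_le_ncard_sdiff_add_ncard T S
  omega

end IsIsland

theorem ncard_range_inl (n m : ℕ) :
    (Set.range (Sum.inl : Fin n → Fin n ⊕ Fin m)).ncard = n := by
  rw [← Set.image_univ, Set.ncard_image_of_injective _ Sum.inl_injective, Set.ncard_univ,
    Nat.card_fin]

theorem ncard_range_inr (n m : ℕ) :
    (Set.range (Sum.inr : Fin m → Fin n ⊕ Fin m)).ncard = m := by
  rw [← Set.image_univ, Set.ncard_image_of_injective _ Sum.inr_injective, Set.ncard_univ,
    Nat.card_fin]

theorem lt_add_ncard_of_isIsland_completeBipartiteGraph {t m : ℕ} {S : Set (Fin t ⊕ Fin m)}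
    (h : IsIsland (completeBipartiteGraph (Fin t) (Fin m)) t S) : m < t + S.ncard := by
  by_cases hl : ∃ i, Sum.inl i ∈ S
  · obtain ⟨i, hi⟩ := hl
    have := h.ncard_lt_add hi (T := Set.range Sum.inr) (by
      rintro _ ⟨j, rfl⟩
      simp)
    rwa [ncard_range_inr] at this
  · push Not at hl
    obtain ⟨v | j, hv⟩ := h.1
    · exact absurd hv (hl v)
    · have := h.ncard_lt_of_disjoint hv (T := Set.range Sum.inl) (by
        rintro _ ⟨i, rfl⟩
        simp) (Set.disjoint_left.2 (by rintro _ ⟨i, rfl⟩; exact hl i))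
      rw [ncard_range_inl] at this
      exact absurd this (lt_irrefl _)

theorem IplusP_adj_inl_inr {n m : ℕ} (i : Fin n) (j : Fin m) :
    (IplusP n m).Adj (Sum.inl i) (Sum.inr j) := by
  simp [IplusP]

theorem IplusP_adj_inr_inr {n m : ℕ} {i j : Fin m} (h : (i : ℕ) + 1 = j) :
    (IplusP n m).Adj (Sum.inr i) (Sum.inr j) := by
  have hne : i ≠ j := by rintro rfl; omega
  simp [IplusP, hne, h]

theorem lt_add_ncard_of_isIsland_IplusP {n m : ℕ} {S : Set (Fin n ⊕ Fin m)}
    (h : IsIsland (IplusP n m) (n + 1) S) : m < n + 1 + S.ncard := by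
  by_cases hl : ∃ i, Sum.inl i ∈ S
  · obtain ⟨i, hi⟩ := hl
    have := h.ncard_lt_add hi (T := Set.range Sum.inr) (by
      rintro _ ⟨j, rfl⟩
      exact IplusP_adj_inl_inr i j)
    rwa [ncard_range_inr] at this
  · push Not at hl
    have step (i j : Fin m) (hi : Sum.inr i ∈ S)
        (hij : (IplusP n m).Adj (Sum.inr i) (Sum.inr j)) : Sum.inr j ∈ S := by
      by_contra hj
      have := h.ncard_lt_of_disjoint hi (T := insert (Sum.inr j) (Set.range Sum.inl)) (by
        rintro _ (rfl | ⟨k, rfl⟩)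
        · exact hij
        · exact (IplusP_adj_inl_inr k i).symm) (Set.disjoint_left.2 (by
        rintro _ (rfl | ⟨k, rfl⟩)
        · exact hj
        · exact hl k))
      rw [Set.ncard_insert_of_notMem (by simp), ncard_range_inl] at this
      exact absurd this (lt_irrefl _)
    obtain ⟨v | j, hv⟩ := h.1
    · exact absurd hv (hl v)
    · have up (k : ℕ) (hk : (j : ℕ) ≤ k) : ∀ hm : k < m, Sum.inr ⟨k, hm⟩ ∈ S := by
        induction k, hk using Nat.le_induction with
        | base => exact fun _ => hv
        | succ k _ ih =>
          exact fun hm => step _ _ (ih (by omega)) (IplusP_adj_inr_inr rfl)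
      have down (k : ℕ) (hk : k ≤ j) : Sum.inr ⟨k, hk.trans_lt j.2⟩ ∈ S := by
        induction hk using Nat.decreasingInduction with
        | self => exact hv
        | of_succ k _ ih => exact step _ _ ih (IplusP_adj_inr_inr rfl).symm
      have hsub : Set.range Sum.inr ⊆ S := by
        rintro _ ⟨k, rfl⟩
        rcases le_total (j : ℕ) k with hk | hk
        · exact up k hk k.2
        · exact down k hk
      have := Set.ncard_le_ncard hsub
      rw [ncard_range_inr] at this
      omega

/-- for every `t ≥ 1` and `C ≥ 1` there exists `m ≥ 1` such that all
`t`-islands in `K_{t,m}` and in `I_{t-1}+P_m` have more than `C` vertices. -/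
theorem stmt1 (t : ℕ) (ht : 1 ≤ t) (C : ℕ) (hC : 1 ≤ C) :
    ∃ m : ℕ, 1 ≤ m ∧
      (∀ S : Set (Fin t ⊕ Fin m),
        IsIsland (completeBipartiteGraph (Fin t) (Fin m)) t S → C < S.ncard) ∧
      (∀ S : Set (Fin (t-1) ⊕ Fin m),
        IsIsland (IplusP (t-1) m) t S → C < S.ncard) := by
  refine ⟨t + C, by omega, fun S hS => ?_, fun S hS => ?_⟩
  · have := lt_add_ncard_of_isIsland_completeBipartiteGraph hS
    omega
  · obtain ⟨n, rfl⟩ := Nat.exists_eq_add_of_le' ht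
    have := lt_add_ncard_of_isIsland_IplusP hS
    omega
end

section
/- For all positive integers C and t there exists a positive integer m such that χ^l_C(K_{t,m}) ≥ t+1 and χ^l_C(I_{t-1}+P_m) ≥ t+1; that is, there exist t-list assignments L₁ for K_{t,m} and L₂ for I_{t-1}+P_m such that K_{t,m} admits no L₁-coloring with clustering C and I_{t-1}+P_m admits no L₂-coloring with clustering C. -/
open SimpleGraph

/-- In a clustered coloring, a vertex has fewer than `C` neighbors sharing its color. -/
lemma ClusteredColoring.card_lt_of_star {V α : Type*} {G : SimpleGraph V} {C : ℕ} {c : V → α}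
    (h : ClusteredColoring G C c) (v : V) (S : Finset V) (hadj : ∀ u ∈ S, G.Adj v u)
    (hc : ∀ u ∈ S, c u = c v) : S.card < C := by
  classical
  have hv : v ∉ S := fun hv => G.loopless.irrefl v (hadj v hv)
  have hconn : (G.induce (↑(insert v S) : Set V)).Connected := by
    rw [SimpleGraph.connected_iff_exists_forall_reachable]
    refine ⟨⟨v, by simp⟩, ?_⟩
    rintro ⟨u, hu⟩
    rcases Finset.mem_insert.1 (Finset.mem_coe.1 hu) with rfl | hu'
    · exact SimpleGraph.Reachable.refl _
    · exact SimpleGraph.Adj.reachable (hadj u hu')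
  have hcol : ∀ u ∈ (↑(insert v S) : Set V), c u = c v := by
    intro u hu
    rcases Finset.mem_insert.1 (Finset.mem_coe.1 hu) with rfl | hu'
    · rfl
    · exact hc u hu'
  have := h _ hconn fun u hu w hw => (hcol u hu).trans (hcol w hw).symm
  rw [Set.ncard_coe_finset, Finset.card_insert_of_notMem hv] at this
  omega

/-- A clustered coloring is not constant on a path with more than `C` vertices. -/
lemma ClusteredColoring.not_const_on_path {V α : Type*} {G : SimpleGraph V} {C : ℕ} {c : V → α}
    (h : ClusteredColoring G C c) (p : Fin (C + 1) → V) (hp : Function.Injective p)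
    (hadj : ∀ i j : Fin (C + 1), (i : ℕ) + 1 = j → G.Adj (p i) (p j)) (a : α) :
    ∃ i, c (p i) ≠ a := by
  by_contra! hc
  have hconn : (G.induce (Set.range p)).Connected := by
    let φ : SimpleGraph.pathGraph (C + 1) →g G.induce (Set.range p) :=
      { toFun := fun i => ⟨p i, i, rfl⟩
        map_rel' := by
          intro i j hij
          rcases SimpleGraph.pathGraph_adj.1 hij with hij | hij
          · exact hadj i j hij
          · exact (hadj j i hij).symm }
    have hφ : Function.Surjective φ := by
      rintro ⟨_, i, rfl⟩
      exact ⟨i, rfl⟩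
    exact (SimpleGraph.pathGraph_connected C).map φ hφ
  have := h _ hconn (by rintro _ ⟨i, rfl⟩ _ ⟨j, rfl⟩; rw [hc i, hc j])
  rw [← Set.image_univ, Set.ncard_image_of_injective _ hp, Set.ncard_univ, Nat.card_fin] at this
  omega

/-- A finite type is enumerated by an initial segment of the natural numbers. -/
lemma exists_enumeration (F : Type*) [Finite F] [Nonempty F] :
    ∃ (K : ℕ) (g : ℕ → F), ∀ f, ∃ k < K, g k = f := by
  obtain ⟨n, ⟨e⟩⟩ := Finite.exists_equiv_fin F
  refine ⟨n, fun k => if h : k < n then e.symm ⟨k, h⟩ else Classical.arbitrary F, fun f => ?_⟩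
  exact ⟨e f, (e f).2, by simp⟩

/-- The list assignment in which the `i`-th hub has list `{i} × [t]` (encoded by pairing), and the
`j`-th remaining vertex has as its list the graph of the function `g (j / N)`. -/
def transversalLists (t N : ℕ) (g : ℕ → Fin t → Fin t) {n m : ℕ} :
    Fin n ⊕ Fin m → Finset ℕ
  | .inl i => Finset.univ.image fun x : Fin t => Nat.pair i x
  | .inr j => Finset.univ.image fun i : Fin t => Nat.pair i (g (j / N) i)

lemma card_transversalLists (t N : ℕ) (g : ℕ → Fin t → Fin t) {n m : ℕ} (v : Fin n ⊕ Fin m) :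
    t ≤ (transversalLists t N g v).card := by
  rcases v with i | j
  · rw [transversalLists, Finset.card_image_of_injective, Finset.card_univ, Fintype.card_fin]
    intro x y hxy
    exact Fin.ext (Nat.pair_eq_pair.1 hxy).2
  · rw [transversalLists, Finset.card_image_of_injective, Finset.card_univ, Fintype.card_fin]
    intro x y hxy
    exact Fin.ext (Nat.pair_eq_pair.1 hxy).1

/-- For every coloring from `transversalLists` there is a block of `N` consecutive vertices all of
whose colors are of the form `(i, f i)`, where `(i, f i)` is the color of the `i`-th hub. -/
lemma exists_transversal_block {t N K n : ℕ} (hnt : n ≤ t) (hN : 0 < N) {g : ℕ → Fin t → Fin t}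
    (ht : 0 < t) (hg : ∀ f, ∃ k < K, g k = f) (c : Fin n ⊕ Fin (K * N) → ℕ)
    (hc : ∀ v, c v ∈ transversalLists t N g v) :
    ∃ (f : Fin t → Fin t) (b : Fin N → Fin (K * N)) (d : Fin N → Fin t) (a : ℕ),
      (∀ r, (b r : ℕ) = a + r) ∧
      (∀ i : Fin n, c (.inl i) = Nat.pair i (f (Fin.castLE hnt i))) ∧
      ∀ r, c (.inr (b r)) = Nat.pair (d r) (f (d r)) := by
  have hub : ∀ i : Fin n, ∃ x : Fin t, Nat.pair i x = c (.inl i) := fun i => by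
    simpa [transversalLists] using hc (.inl i)
  choose x hx using hub
  let f : Fin t → Fin t := fun i => if h : (i : ℕ) < n then x ⟨i, h⟩ else ⟨0, ht⟩
  obtain ⟨k, hk, hgk⟩ := hg f
  have hlt : ∀ r : Fin N, k * N + r < K * N := fun r => by
    have : (k + 1) * N ≤ K * N := Nat.mul_le_mul_right _ hk
    have := r.2
    linarith [add_mul k 1 N]
  have hd : ∀ r : Fin N, ∃ i : Fin t,
      Nat.pair i (f i) = c (.inr ⟨k * N + r, hlt r⟩) := fun r => by
    have hdiv : (k * N + r) / N = k := by
      rw [mul_comm, Nat.mul_add_div hN, Nat.div_eq_of_lt r.2, add_zero]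
    simpa [transversalLists, hdiv, hgk] using hc (.inr ⟨k * N + r, hlt r⟩)
  choose d hd using hd
  refine ⟨f, fun r => ⟨k * N + r, hlt r⟩, d, k * N, fun _ => rfl, fun i => ?_,
    fun r => (hd r).symm⟩
  simp [f, hx]

lemma not_clusteredColoring_completeBipartiteGraph {C t N K : ℕ} (hN : t * C ≤ N) (hN0 : 0 < N)
    (ht : 0 < t) {g : ℕ → Fin t → Fin t} (hg : ∀ f, ∃ k < K, g k = f)
    (c : Fin t ⊕ Fin (K * N) → ℕ) (hc : ∀ v, c v ∈ transversalLists t N g v) :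
    ¬ ClusteredColoring (completeBipartiteGraph (Fin t) (Fin (K * N))) C c := by
  classical
  intro h
  obtain ⟨f, b, d, a, hb, hhub, hd⟩ := exists_transversal_block le_rfl hN0 ht hg c hc
  have : Nonempty (Fin t) := ⟨⟨0, ht⟩⟩
  obtain ⟨i, -, hi⟩ := Finset.exists_le_card_fiber_of_mul_le_card_of_maps_to
    (s := (Finset.univ : Finset (Fin N))) (t := (Finset.univ : Finset (Fin t))) (f := d) (n := C)
    (fun _ _ => Finset.mem_univ _) Finset.univ_nonempty (by simpa using hN)
  have hinj : Function.Injective fun r => (Sum.inr (b r) : Fin t ⊕ Fin (K * N)) := by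
    intro r s hrs
    have := congrArg Fin.val (Sum.inr_injective hrs)
    rw [hb, hb] at this
    exact Fin.ext (by omega)
  have := h.card_lt_of_star (.inl i)
    ((Finset.univ.filter fun r => d r = i).image fun r => Sum.inr (b r))
    (by simp)
    (by
      intro u hu
      obtain ⟨r, hr, rfl⟩ := Finset.mem_image.1 hu
      obtain rfl := (Finset.mem_filter.1 hr).2
      rw [hd, hhub, Fin.castLE_rfl, id])
  rw [Finset.card_image_of_injective _ hinj] at this
  omega

lemma not_clusteredColoring_IplusP {C s N K : ℕ} (hC : 1 ≤ C) (hN : (s + 1) * C * (C + 1) ≤ N)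
    (hN0 : 0 < N) {g : ℕ → Fin (s + 1) → Fin (s + 1)} (hg : ∀ f, ∃ k < K, g k = f)
    (c : Fin s ⊕ Fin (K * N) → ℕ) (hc : ∀ v, c v ∈ transversalLists (s + 1) N g v) :
    ¬ ClusteredColoring (IplusP s (K * N)) C c := by
  classical
  intro h
  obtain ⟨f, b, d, a, hb, hhub, hd⟩ :=
    exists_transversal_block (Nat.le_succ s) hN0 s.succ_pos hg c hc
  have hinj : Function.Injective fun r => (Sum.inr (b r) : Fin s ⊕ Fin (K * N)) := by
    intro r s hrs
    have := congrArg Fin.val (Sum.inr_injective hrs)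
    rw [hb, hb] at this
    exact Fin.ext (by omega)
  have hlt : ∀ (w : Fin ((s + 1) * C)) (r : Fin (C + 1)), w * (C + 1) + r < N := fun w r => by
    have h1 : ((w : ℕ) + 1) * (C + 1) ≤ (s + 1) * C * (C + 1) := Nat.mul_le_mul_right _ w.2
    have := r.2
    linarith [add_mul (w : ℕ) 1 (C + 1)]
  have hwin : ∀ w : Fin ((s + 1) * C), ∃ r : Fin (C + 1),
      ∃ i : Fin s, d ⟨w * (C + 1) + r, hlt w r⟩ = i.castSucc := by
    intro w
    obtain ⟨r, hr⟩ := h.not_const_on_path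
      (fun r => Sum.inr (b ⟨w * (C + 1) + r, hlt w r⟩))
      (fun r r' hrr => by simpa [Fin.ext_iff] using hinj hrr)
      (fun r r' hrr => by
        rw [IplusP, SimpleGraph.fromRel_adj]
        refine ⟨fun he => ?_, Or.inl (Or.inr ⟨_, _, rfl, rfl, ?_⟩)⟩
        · have := hinj he
          simp only [Fin.mk.injEq] at this
          omega
        · rw [hb, hb]
          simp only
          omega)
      (Nat.pair (Fin.last s : Fin (s + 1)) (f (Fin.last s)))
    refine ⟨r, ?_⟩
    rcases Fin.eq_castSucc_or_eq_last (d ⟨w * (C + 1) + r, hlt w r⟩) with hi | hi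
    · exact hi
    · exact absurd (by rw [hd, hi]) hr
  choose r e he using hwin
  obtain ⟨i, -, hi⟩ := Finset.exists_lt_card_fiber_of_mul_lt_card_of_maps_to
    (s := (Finset.univ : Finset (Fin ((s + 1) * C)))) (t := (Finset.univ : Finset (Fin s)))
    (f := e) (n := C) (fun _ _ => Finset.mem_univ _) (by simp [add_mul]; omega)
  have hinj' : Function.Injective fun w : Fin ((s + 1) * C) =>
      (Sum.inr (b ⟨w * (C + 1) + r w, hlt w (r w)⟩) : Fin s ⊕ Fin (K * N)) := by
    intro w w' hw
    have := congrArg (fun x : Fin N => (x : ℕ) / (C + 1)) (hinj hw)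
    simp only [mul_comm _ (C + 1), Nat.mul_add_div C.succ_pos, Nat.div_eq_of_lt (r _).2,
      add_zero] at this
    exact Fin.ext this
  have := h.card_lt_of_star (.inl i)
    ((Finset.univ.filter fun w => e w = i).image fun w =>
      Sum.inr (b ⟨w * (C + 1) + r w, hlt w (r w)⟩))
    (by
      intro u hu
      obtain ⟨w, -, rfl⟩ := Finset.mem_image.1 hu
      rw [IplusP, SimpleGraph.fromRel_adj]
      exact ⟨by simp, Or.inl (Or.inl ⟨_, _, rfl, rfl⟩)⟩)
    (by
      intro u hu
      obtain ⟨w, hw, rfl⟩ := Finset.mem_image.1 hu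
      obtain rfl := (Finset.mem_filter.1 hw).2
      rw [hd, hhub, he]
      rfl)
  rw [Finset.card_image_of_injective _ hinj'] at this
  omega

/-- for all positive `C, t` there is `m` with `χ^l_C(K_{t,m}) ≥ t+1` and
`χ^l_C(I_{t-1}+P_m) ≥ t+1`, witnessed by `t`-list assignments admitting no coloring with
clustering `C`. -/
theorem stmt2 (C t : ℕ) (hC : 1 ≤ C) (ht : 1 ≤ t) :
    ∃ m : ℕ, 1 ≤ m ∧
      (∃ L : (Fin t ⊕ Fin m) → Finset ℕ, (∀ v, t ≤ (L v).card) ∧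
        ¬ ∃ c : (Fin t ⊕ Fin m) → ℕ, (∀ v, c v ∈ L v) ∧
          ClusteredColoring (completeBipartiteGraph (Fin t) (Fin m)) C c) ∧
      (∃ L : (Fin (t-1) ⊕ Fin m) → Finset ℕ, (∀ v, t ≤ (L v).card) ∧
        ¬ ∃ c : (Fin (t-1) ⊕ Fin m) → ℕ, (∀ v, c v ∈ L v) ∧
          ClusteredColoring (IplusP (t-1) m) C c) := by
  obtain ⟨s, rfl⟩ : ∃ s, t = s + 1 := ⟨t - 1, by omega⟩
  obtain ⟨K, g, hg⟩ := exists_enumeration (Fin (s + 1) → Fin (s + 1))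
  have hN : 0 < (s + 1) * C * (C + 1) := by positivity
  have hK : 0 < K := by
    obtain ⟨k, hk, -⟩ := hg id
    omega
  refine ⟨K * ((s + 1) * C * (C + 1)), Nat.mul_pos hK hN,
    ⟨transversalLists (s + 1) ((s + 1) * C * (C + 1)) g, card_transversalLists _ _ _, ?_⟩,
    ⟨transversalLists (s + 1) ((s + 1) * C * (C + 1)) g, card_transversalLists _ _ _, ?_⟩⟩
  · rintro ⟨c, hc, h⟩
    exact not_clusteredColoring_completeBipartiteGraph
      (Nat.le_mul_of_pos_right _ C.succ_pos) hN s.succ_pos hg c hc h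
  · rintro ⟨c, hc, h⟩
    exact not_clusteredColoring_IplusP hC le_rfl hN hg c hc h
end

section
/- Let t ≥ 1 and C ≥ 1 be integers and let 𝒢 be a class of finite graphs such that every graph G ∈ 𝒢 admits an L-coloring with clustering C for every t-list assignment L. Then there exists an integer m ≥ 1 such that K_{t,m} ∉ 𝒢 and I_{t-1}+P_m ∉ 𝒢. -/
open SimpleGraph

/-- Clustered list colorability of the members of a class transfers along isomorphism. -/
theorem MemClass.exists_clusteredColoring {t C : ℕ}
    {𝒢 : ∀ n : ℕ, SimpleGraph (Fin n) → Prop}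
    (hcol : ∀ (n : ℕ) (G : SimpleGraph (Fin n)), 𝒢 n G →
      ∀ L : Fin n → Finset ℕ, (∀ v, t ≤ (L v).card) →
        ∃ c : Fin n → ℕ, (∀ v, c v ∈ L v) ∧ ClusteredColoring G C c)
    {V : Type*} {G : SimpleGraph V} (hG : MemClass 𝒢 G) (L : V → Finset ℕ)
    (hL : ∀ v, t ≤ (L v).card) :
    ∃ c : V → ℕ, (∀ v, c v ∈ L v) ∧ ClusteredColoring G C c := by
  obtain ⟨n, G', hG', ⟨e⟩⟩ := hG
  obtain ⟨c, hc, hcl⟩ := hcol n G' hG' (fun v => L (e.symm v)) (fun v => hL _)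
  refine ⟨c ∘ e, fun v => by simpa using hc (e v), fun S hS hmono => ?_⟩
  rw [← Set.ncard_image_of_injective S e.injective]
  refine hcl _ ?_ ?_
  · let f : G.induce S →g G'.induce (e '' S) :=
      ⟨fun v => ⟨e v, Set.mem_image_of_mem e v.2⟩, fun {a b} h => e.map_adj_iff.2 h⟩
    refine hS.map f ?_
    rintro ⟨_, v, hv, rfl⟩
    exact ⟨⟨v, hv⟩, rfl⟩
  · rintro _ ⟨u, hu, rfl⟩ _ ⟨v, hv, rfl⟩
    exact hmono u hu v hv

/-- In a coloring with clustering `C`, fewer than `C` neighbors of a vertex share its color. -/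
theorem ClusteredColoring.card_neighbors_lt {V α : Type*} {G : SimpleGraph V} {C : ℕ}
    {c : V → α} (hc : ClusteredColoring G C c) (v : V) (T : Finset V)
    (hadj : ∀ u ∈ T, G.Adj v u) (hmono : ∀ u ∈ T, c u = c v) : T.card < C := by
  classical
  have hv : v ∉ T := fun h => G.loopless.irrefl v (hadj v h)
  have key := hc (insert v T : Finset V) ?_ ?_
  · rw [Set.ncard_coe_finset, Finset.card_insert_of_notMem hv] at key
    omega
  · rw [connected_iff_exists_forall_reachable]
    refine ⟨⟨v, by simp⟩, ?_⟩
    rintro ⟨u, hu⟩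
    rcases Finset.mem_insert.1 (Finset.mem_coe.1 hu) with rfl | hu'
    · exact Reachable.refl _
    · exact Adj.reachable (by simpa using hadj u hu')
  · have h : ∀ u ∈ insert v T, c u = c v := by
      simpa using hmono
    intro u hu w hw
    rw [h u hu, h w hw]

/-- If every `inl` vertex is adjacent to every `inr` vertex, few `inr` vertices have the color
of some `inl` vertex. -/
theorem ClusteredColoring.card_inr_le {α : Type*} [DecidableEq α] {s m C : ℕ}
    {G : SimpleGraph (Fin s ⊕ Fin m)} (hG : ∀ i j, G.Adj (Sum.inl i) (Sum.inr j))
    {c : Fin s ⊕ Fin m → α} (hc : ClusteredColoring G C c) (T : Finset (Fin m))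
    (hT : ∀ j ∈ T, ∃ i, c (Sum.inl i) = c (Sum.inr j)) : T.card ≤ s * C := by
  have hsub : T ⊆ Finset.univ.biUnion
      (fun i : Fin s => T.filter (fun j => c (Sum.inr j) = c (Sum.inl i))) := by
    intro j hj
    obtain ⟨i, hi⟩ := hT j hj
    simpa [hj] using ⟨i, hi.symm⟩
  refine (Finset.card_le_card hsub).trans ?_
  have := Finset.card_biUnion_le_card_mul Finset.univ
    (fun i : Fin s => T.filter (fun j => c (Sum.inr j) = c (Sum.inl i))) C (fun i _ => by
      have := hc.card_neighbors_lt (Sum.inl i)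
        ((T.filter (fun j => c (Sum.inr j) = c (Sum.inl i))).map Function.Embedding.inr)
        (by simp [hG]) (by
          rintro u hu
          obtain ⟨j, hj, rfl⟩ := Finset.mem_map.1 hu
          exact (Finset.mem_filter.1 hj).2)
      rw [Finset.card_map] at this
      exact this.le)
  simpa using this

/-- Lists for which every coloring has a long interval of `inr` vertices whose lists consist of
colors used on `inl` vertices. The color `0` is left unused. -/
theorem exists_lists_forcing_interval (s t N : ℕ) (ht : 1 ≤ t) :
    ∃ B, ∀ m, B ≤ m → ∃ L : Fin s ⊕ Fin m → Finset ℕ,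
      (∀ i, (L (Sum.inl i)).card = t) ∧ (∀ j, (L (Sum.inr j)).card = s) ∧
      (∀ v, 0 ∉ L v) ∧
      ∀ c : Fin s ⊕ Fin m → ℕ, (∀ i, c (Sum.inl i) ∈ L (Sum.inl i)) →
        ∃ a, a + N ≤ m ∧ ∀ j : Fin m, a ≤ j → (j : ℕ) < a + N →
          ∀ x ∈ L (Sum.inr j), ∃ i, c (Sum.inl i) = x := by
  classical
  have : NeZero t := ⟨by omega⟩
  let e := Fintype.equivFin (Fin s → Fin t)
  let M := Fintype.card (Fin s → Fin t)
  let d : ℕ → Fin s → Fin t := fun q => if h : q < M then e.symm ⟨q, h⟩ else 0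
  have hpos : ∀ i k, Nat.pair (i + 1) k ≠ 0 := fun i k h => by
    have := Nat.left_le_pair (i + 1) k
    omega
  refine ⟨M * N, fun m hm => ⟨Sum.elim
    (fun i => Finset.univ.image (fun k : Fin t => Nat.pair (i + 1) k))
    (fun j => Finset.univ.image (fun i : Fin s => Nat.pair (i + 1) (d (j / N) i))),
    ?_, ?_, ?_, ?_⟩⟩
  · intro i
    rw [Sum.elim_inl, Finset.card_image_of_injective _ ?_]
    · simp
    · intro a b h
      simpa [Nat.pair_eq_pair, Fin.ext_iff] using h
  · intro j
    rw [Sum.elim_inr, Finset.card_image_of_injective _ ?_]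
    · simp
    · intro a b h
      simp only [Nat.pair_eq_pair] at h
      exact Fin.ext (by omega)
  · rintro (i | j) <;> simp [hpos]
  · intro c hc
    have hc' : ∀ i : Fin s, ∃ k : Fin t, Nat.pair (i + 1) k = c (Sum.inl i) := fun i => by
      simpa using hc i
    choose f hf using hc'
    have hq : (e f : ℕ) < M := (e f).2
    refine ⟨e f * N, ?_, ?_⟩
    · refine le_trans ?_ hm
      rw [← Nat.succ_mul]
      exact Nat.mul_le_mul_right N hq
    · intro j h₁ h₂ x hx
      have hdiv : (j : ℕ) / N = e f :=
        Nat.div_eq_of_lt_le h₁ (by rw [Nat.succ_mul]; exact h₂)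
      have hd : d (e f) = f := by simp [d, hq]
      simp only [Sum.elim_inr, Finset.mem_image, Finset.mem_univ, true_and, hdiv, hd] at hx
      obtain ⟨i, rfl⟩ := hx
      exact ⟨i, (hf i).symm⟩

/-- The `Fin m`-interval `[a, a + N)` has `N` elements when it fits. -/
theorem Fin.card_filter_interval {m a N : ℕ} (h : a + N ≤ m) :
    (Finset.univ.filter (fun j : Fin m => a ≤ j ∧ (j : ℕ) < a + N)).card = N := by
  have hmap : (Finset.univ.filter (fun j : Fin m => a ≤ j ∧ (j : ℕ) < a + N)).map
      Fin.valEmbedding = Finset.Ico a (a + N) := by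
    ext x
    simp only [Finset.mem_map, Finset.mem_filter, Finset.mem_univ, true_and, Finset.mem_Ico,
      Fin.valEmbedding_apply]
    exact ⟨by rintro ⟨j, hj, rfl⟩; exact hj, fun hx => ⟨⟨x, by omega⟩, hx, rfl⟩⟩
  rw [← Finset.card_map Fin.valEmbedding, hmap, Nat.card_Ico]
  omega

theorem exists_not_memClass_completeBipartiteGraph {t C : ℕ} (ht : 1 ≤ t)
    {𝒢 : ∀ n : ℕ, SimpleGraph (Fin n) → Prop}
    (hcol : ∀ (n : ℕ) (G : SimpleGraph (Fin n)), 𝒢 n G →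
      ∀ L : Fin n → Finset ℕ, (∀ v, t ≤ (L v).card) →
        ∃ c : Fin n → ℕ, (∀ v, c v ∈ L v) ∧ ClusteredColoring G C c) :
    ∃ B, ∀ m, B ≤ m → ¬ MemClass 𝒢 (completeBipartiteGraph (Fin t) (Fin m)) := by
  obtain ⟨B, hB⟩ := exists_lists_forcing_interval t t (t * C + 1) ht
  refine ⟨B, fun m hm hmem => ?_⟩
  obtain ⟨L, hl, hr, -, hforce⟩ := hB m hm
  obtain ⟨c, hcL, hc⟩ := hmem.exists_clusteredColoring hcol L
    (by rintro (i | j) <;> simp [hl, hr])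
  obtain ⟨a, ha, hblock⟩ := hforce c (fun i => hcL _)
  have := hc.card_inr_le (by simp)
    (Finset.univ.filter (fun j : Fin m => a ≤ j ∧ (j : ℕ) < a + (t * C + 1)))
    (fun j hj => by
      have hj' := (Finset.mem_filter.1 hj).2
      exact hblock j hj'.1 hj'.2 _ (hcL _))
  rw [Fin.card_filter_interval ha] at this
  omega

/-- A nonempty interval of the path of `I_n + P_m` induces a connected graph. -/
theorem IplusP_induce_interval_connected {n m a N : ℕ} (h : a + (N + 1) ≤ m) :
    ((IplusP n m).induce (((Finset.univ.filter
      (fun j : Fin m => a ≤ j ∧ (j : ℕ) < a + (N + 1))).map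
        Function.Embedding.inr : Finset (Fin n ⊕ Fin m)) : Set (Fin n ⊕ Fin m))).Connected := by
  rw [connected_iff_exists_forall_reachable]
  have hmem : ∀ k ≤ N, ∀ hk : a + k < m, (Sum.inr ⟨a + k, hk⟩ : Fin n ⊕ Fin m) ∈
      (((Finset.univ.filter (fun j : Fin m => a ≤ j ∧ (j : ℕ) < a + (N + 1))).map
        Function.Embedding.inr : Finset (Fin n ⊕ Fin m)) : Set (Fin n ⊕ Fin m)) := by
    intro k hk hkm
    simp
    omega
  refine ⟨⟨_, hmem 0 (by omega) (by omega)⟩, ?_⟩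
  have hreach : ∀ k, ∀ hk : k ≤ N, ((IplusP n m).induce _).Reachable
      ⟨_, hmem 0 (by omega) (by omega)⟩ ⟨_, hmem k hk (by omega)⟩ := by
    intro k
    induction k with
    | zero => exact fun _ => Reachable.refl _
    | succ k ih =>
      intro hk
      refine (ih (by omega)).trans (Adj.reachable ?_)
      exact IplusP_adj_inr_inr rfl
  rintro ⟨v, hv⟩
  obtain ⟨j, hj, rfl⟩ := Finset.mem_map.1 (Finset.mem_coe.1 hv)
  have hj' := (Finset.mem_filter.1 hj).2
  obtain ⟨k, hk⟩ := Nat.exists_eq_add_of_le hj'.1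
  have hjk : j = ⟨a + k, hk ▸ j.2⟩ := Fin.ext hk
  simp only [hjk]
  exact hreach k (by omega)

theorem exists_not_memClass_IplusP {s C : ℕ}
    {𝒢 : ∀ n : ℕ, SimpleGraph (Fin n) → Prop}
    (hcol : ∀ (n : ℕ) (G : SimpleGraph (Fin n)), 𝒢 n G →
      ∀ L : Fin n → Finset ℕ, (∀ v, s + 1 ≤ (L v).card) →
        ∃ c : Fin n → ℕ, (∀ v, c v ∈ L v) ∧ ClusteredColoring G C c) :
    ∃ B, ∀ m, B ≤ m → ¬ MemClass 𝒢 (IplusP s m) := by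
  obtain ⟨B, hB⟩ := exists_lists_forcing_interval s (s + 1) ((s * C + 1) * (C + 1)) (by omega)
  refine ⟨B, fun m hm hmem => ?_⟩
  obtain ⟨L, hl, hr, h0, hforce⟩ := hB m hm
  obtain ⟨c, hcL, hc⟩ := hmem.exists_clusteredColoring hcol
    (Sum.elim (fun i => L (Sum.inl i)) (fun j => insert 0 (L (Sum.inr j))))
    (by rintro (i | j) <;> simp [hl, hr, h0])
  obtain ⟨a, ha, hblock⟩ := hforce c (fun i => hcL (Sum.inl i))
  have hfit : ∀ b < s * C + 1, b * (C + 1) + (C + 1) ≤ (s * C + 1) * (C + 1) := fun b hb => by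
    rw [← Nat.succ_mul]
    exact Nat.mul_le_mul_right _ hb
  have hbad : ∀ b : Fin (s * C + 1), ∃ j : Fin m,
      a + b * (C + 1) ≤ j ∧ (j : ℕ) < a + b * (C + 1) + (C + 1) ∧ c (Sum.inr j) ≠ 0 := by
    intro b
    by_contra! hzero
    have hb := hfit b b.2
    have hle := hc _ (IplusP_induce_interval_connected
      (a := a + b * (C + 1)) (N := C) (by omega)) (by
        have hz : ∀ u ∈ (Finset.univ.filter (fun j : Fin m => a + b * (C + 1) ≤ j ∧
            (j : ℕ) < a + b * (C + 1) + (C + 1))).map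
              (Function.Embedding.inr (α := Fin s)), c u = 0 := by
          intro u hu
          obtain ⟨j, hj, rfl⟩ := Finset.mem_map.1 hu
          have hj' := (Finset.mem_filter.1 hj).2
          exact hzero j hj'.1 hj'.2
        intro u hu v hv
        rw [hz u hu, hz v hv])
    rw [Set.ncard_coe_finset, Finset.card_map, Fin.card_filter_interval (by omega)] at hle
    omega
  choose g hg₁ hg₂ hg₃ using hbad
  have hinj : Function.Injective g := by
    intro b b' hbb
    have hdiv : ∀ b, ((g b : ℕ) - a) / (C + 1) = b := fun b =>
      Nat.div_eq_of_lt_le (by have := hg₁ b; omega)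
        (by rw [Nat.succ_mul]; have := hg₂ b; omega)
    exact Fin.ext (by rw [← hdiv b, ← hdiv b', hbb])
  have := hc.card_inr_le IplusP_adj_inl_inr (Finset.univ.image g) (by
    intro j hj
    obtain ⟨b, -, rfl⟩ := Finset.mem_image.1 hj
    have hb := hfit b b.2
    have h₁ := hg₁ b
    have h₂ := hg₂ b
    refine hblock (g b) (by omega) (by omega) _ ?_
    exact (Finset.mem_insert.1 (hcL (Sum.inr (g b)))).resolve_left (hg₃ b))
  rw [Finset.card_image_of_injective _ hinj, Finset.card_univ, Fintype.card_fin] at this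
  omega

/-- if every graph in the class `𝒢` admits an `L`-coloring with clustering `C`
for every `t`-list assignment `L`, then for some `m ≥ 1` neither `K_{t,m}` nor
`I_{t-1}+P_m` belongs to `𝒢`. -/
theorem stmt3 (t C : ℕ) (ht : 1 ≤ t) (hC : 1 ≤ C)
    (𝒢 : ∀ n : ℕ, SimpleGraph (Fin n) → Prop)
    (hcol : ∀ (n : ℕ) (G : SimpleGraph (Fin n)), 𝒢 n G →
      ∀ L : Fin n → Finset ℕ, (∀ v, t ≤ (L v).card) →
        ∃ c : Fin n → ℕ, (∀ v, c v ∈ L v) ∧ ClusteredColoring G C c) :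
    ∃ m : ℕ, 1 ≤ m ∧ ¬ MemClass 𝒢 (completeBipartiteGraph (Fin t) (Fin m)) ∧
      ¬ MemClass 𝒢 (IplusP (t-1) m) := by
  obtain ⟨B₁, h₁⟩ := exists_not_memClass_completeBipartiteGraph ht hcol
  obtain ⟨s, rfl⟩ : ∃ s, t = s + 1 := ⟨t - 1, by omega⟩
  obtain ⟨B₂, h₂⟩ := exists_not_memClass_IplusP hcol
  exact ⟨B₁ + B₂ + 1, by omega, h₁ _ (by omega), h₂ _ (by omega)⟩
end

section
/- Let 𝒢 be a minor-closed class of finite graphs of bounded treewidth and let t ≥ 1 be an integer. Then the following are equivalent: (i) there exists an integer C ≥ 1 such that every non-empty graph in 𝒢 contains a t-island of size at most C; (ii) there exists an integer m ≥ 1 such that K_{t,m} ∉ 𝒢 and I_{t-1}+P_m ∉ 𝒢. -/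
open SimpleGraph

section Islands

open scoped Classical

variable {V : Type*}

/-- The sets `Q s`, for `s ∈ S`, are pairwise disjoint subsets of `U`, each being the support of
a walk from `s` to `T`. -/
def IsLinkage (G : SimpleGraph V) (U S T : Finset V) (Q : V → Finset V) : Prop :=
  (∀ s ∈ S, ∃ e ∈ T, ∃ p : G.Walk s e, ∀ u, u ∈ p.support ↔ u ∈ Q s) ∧
    (∀ s ∈ S, Q s ⊆ U) ∧ ∀ s ∈ S, ∀ s' ∈ S, s ≠ s' → Disjoint (Q s) (Q s')

lemma IsLinkage.cons {G : SimpleGraph V} {U S T : Finset V} {Q : V → Finset V} {x y : V}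
    (hSU : S ⊆ U) (hx : x ∈ S) (hy : y ∉ S) (hxy : G.Adj x y)
    (h : IsLinkage G (U.erase x) (insert y (S.erase x)) T Q) :
    ∃ Q', IsLinkage G U S T Q' := by
  obtain ⟨h1, h2, h3⟩ := h
  refine ⟨fun s => if s = x then insert x (Q y) else Q s, ?_, ?_, ?_⟩
  · intro s hs
    by_cases hsx : s = x
    · subst hsx
      obtain ⟨e, he, p, hp⟩ := h1 y (by simp)
      exact ⟨e, he, Walk.cons hxy p, by simp [hp]⟩
    · obtain ⟨e, he, p, hp⟩ := h1 s (by simp [hs, hsx])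
      exact ⟨e, he, p, by simp [hp, hsx]⟩
  · intro s hs u hu
    by_cases hsx : s = x
    · subst hsx
      simp only [if_true, Finset.mem_insert] at hu
      rcases hu with rfl | hu
      · exact hSU hs
      · exact Finset.mem_of_mem_erase (h2 y (by simp) hu)
    · simp only [hsx, if_false] at hu
      exact Finset.mem_of_mem_erase (h2 s (by simp [hs, hsx]) hu)
  · have key : ∀ s ∈ S, s ≠ x → Disjoint (insert x (Q y)) (Q s) := by
      intro s hs hsx
      rw [Finset.disjoint_insert_left]
      refine ⟨fun hxs => ?_, h3 y (by simp) s (by simp [hs, hsx]) fun h => hy (h ▸ hs)⟩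
      have := h2 s (by simp [hs, hsx]) hxs
      simp at this
    intro s hs s' hs' hne
    by_cases hsx : s = x
    · have hsx' : s' ≠ x := fun h => hne (hsx.trans h.symm)
      simpa [hsx, hsx'] using key s' hs' hsx'
    · by_cases hsx' : s' = x
      · simpa [hsx, hsx'] using (key s hs hsx).symm
      · simpa [hsx, hsx'] using h3 s (by simp [hs, hsx]) s' (by simp [hs', hsx']) hne

lemma IsLinkage.append {G : SimpleGraph V} {U U₁ U₂ S R T : Finset V} {Q₁ Q₂ : V → Finset V}
    (h₁ : IsLinkage G U₁ S R Q₁) (h₂ : IsLinkage G U₂ R T Q₂) (hcard : R.card ≤ S.card)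
    (hU₁ : U₁ ⊆ U) (hU₂ : U₂ ⊆ U) (hR : U₁ ∩ U₂ ⊆ R) :
    ∃ Q, IsLinkage G U S T Q := by
  obtain ⟨a1, a2, a3⟩ := h₁
  obtain ⟨b1, b2, b3⟩ := h₂
  have : ∀ s : V, ∃ e, s ∈ S → e ∈ R ∧ ∃ p : G.Walk s e, ∀ u, u ∈ p.support ↔ u ∈ Q₁ s := by
    intro s
    by_cases hs : s ∈ S
    · obtain ⟨e, he⟩ := a1 s hs
      exact ⟨e, fun _ => he⟩
    · exact ⟨s, fun h => absurd h hs⟩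
  choose τ hτ using this
  have hτQ : ∀ s ∈ S, τ s ∈ Q₁ s := by
    intro s hs
    obtain ⟨-, p, hp⟩ := hτ s hs
    exact (hp _).1 p.end_mem_support
  have hinj : ∀ s ∈ S, ∀ s' ∈ S, s ≠ s' → τ s ≠ τ s' := by
    intro s hs s' hs' hne h
    exact Finset.disjoint_left.1 (a3 s hs s' hs' hne) (hτQ s hs) (h ▸ hτQ s' hs')
  have hsurj : ∀ r ∈ R, ∃ s ∈ S, τ s = r := by
    intro r hr
    have hsub : S.image τ ⊆ R := by
      intro r' hr'
      obtain ⟨s, hs, rfl⟩ := Finset.mem_image.1 hr'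
      exact (hτ s hs).1
    have hc : (S.image τ).card = S.card := Finset.card_image_of_injOn
      fun s hs s' hs' h => by_contra fun hne => hinj s hs s' hs' hne h
    have := Finset.eq_of_subset_of_card_le hsub (by omega)
    rw [← this] at hr
    simpa using hr
  have hQ₂ : ∀ r ∈ R, r ∈ Q₂ r := by
    intro r hr
    obtain ⟨e, he, p, hp⟩ := b1 r hr
    exact (hp _).1 p.start_mem_support
  have hcross : ∀ s ∈ S, ∀ s' ∈ S, s ≠ s' → Disjoint (Q₁ s) (Q₂ (τ s')) := by
    intro s hs s' hs' hne
    rw [Finset.disjoint_left]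
    intro u hu hu'
    have huR : u ∈ R := hR (Finset.mem_inter.2 ⟨a2 s hs hu, b2 _ (hτ s' hs').1 hu'⟩)
    obtain ⟨s'', hs'', rfl⟩ := hsurj u huR
    have h1 : s = s'' := by
      by_contra hne'
      exact Finset.disjoint_left.1 (a3 s hs s'' hs'' hne') hu (hτQ s'' hs'')
    subst h1
    exact Finset.disjoint_left.1 (b3 _ (hτ s hs).1 _ (hτ s' hs').1 (hinj s hs s' hs' hne))
      (hQ₂ _ huR) hu'
  refine ⟨fun s => Q₁ s ∪ Q₂ (τ s), ?_, ?_, ?_⟩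
  · intro s hs
    obtain ⟨hr, p, hp⟩ := hτ s hs
    obtain ⟨e, he, q, hq⟩ := b1 _ hr
    exact ⟨e, he, p.append q, by simp [Walk.mem_support_append_iff, hp, hq]⟩
  · intro s hs
    exact Finset.union_subset ((a2 s hs).trans hU₁) ((b2 _ (hτ s hs).1).trans hU₂)
  · intro s hs s' hs' hne
    simp only [Finset.disjoint_union_left, Finset.disjoint_union_right]
    exact ⟨⟨a3 s hs s' hs' hne, (hcross s' hs' s hs hne.symm).symm⟩, hcross s hs s' hs' hne,
      b3 _ (hτ s hs).1 _ (hτ s' hs').1 (hinj s hs s' hs' hne)⟩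

lemma IsLinkage.exists_isPath {G : SimpleGraph V} {U S T : Finset V} {Q : V → Finset V}
    (h : IsLinkage G U S T Q) : ∃ Q' : V → Finset V,
      (∀ s ∈ S, ∃ e ∈ T, ∃ p : G.Walk s e, p.IsPath ∧ ∀ u, u ∈ p.support ↔ u ∈ Q' s) ∧
      ∀ s ∈ S, ∀ s' ∈ S, s ≠ s' → Disjoint (Q' s) (Q' s') := by
  obtain ⟨h1, -, h3⟩ := h
  have : ∀ s, ∃ P : Finset V, s ∈ S → P ⊆ Q s ∧
      ∃ e ∈ T, ∃ p : G.Walk s e, p.IsPath ∧ ∀ u, u ∈ p.support ↔ u ∈ P := by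
    intro s
    by_cases hs : s ∈ S
    · obtain ⟨e, he, p, hp⟩ := h1 s hs
      refine ⟨p.bypass.support.toFinset, fun _ => ⟨fun u hu => ?_, e, he, p.bypass,
        p.bypass_isPath, by simp⟩⟩
      exact (hp u).1 (p.support_bypass_subset_support (by simpa using hu))
    · exact ⟨∅, fun h => absurd h hs⟩
  choose Q' hQ' using this
  exact ⟨Q', fun s hs => (hQ' s hs).2, fun s hs s' hs' hne =>
    Finset.disjoint_of_subset_left (hQ' s hs).1
      (Finset.disjoint_of_subset_right (hQ' s' hs').1 (h3 s hs s' hs' hne))⟩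

variable [Fintype V]

/-- The outer boundary of `X` inside `U`, where the vertices of `S` count as attached to an
external source. -/
noncomputable def sourceBoundary (G : SimpleGraph V) (U S X : Finset V) : Finset V :=
  Finset.univ.filter fun u => u ∈ U ∧ u ∉ X ∧ (u ∈ S ∨ ∃ x ∈ X, G.Adj x u)

lemma mem_sourceBoundary {G : SimpleGraph V} {U S X : Finset V} {u : V} :
    u ∈ sourceBoundary G U S X ↔ u ∈ U ∧ u ∉ X ∧ (u ∈ S ∨ ∃ x ∈ X, G.Adj x u) := by
  simp [sourceBoundary]

/-- A form of Menger's theorem. -/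
theorem exists_isLinkage (G : SimpleGraph V) (k : ℕ) :
    ∀ (U S T : Finset V), S ⊆ U → T ⊆ U → S.card = k →
      (∀ X ⊆ U \ T, k ≤ (sourceBoundary G U S X).card) → ∃ Q, IsLinkage G U S T Q := by
  intro U
  induction hn : U.card using Nat.strong_induction_on generalizing U with
  | _ n ih =>
  subst hn
  intro S T hSU hTU hS hX
  by_cases hST : S ⊆ T
  · exact ⟨fun s => {s}, fun s hs => ⟨s, hST hs, Walk.nil, by simp⟩,
      fun s hs => by simpa using hSU hs, fun s _ s' _ hne => by simpa using hne⟩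
  obtain ⟨x, hxS, hxT⟩ := Finset.not_subset.1 hST
  have hxU := hSU hxS
  have hTcard : k ≤ T.card := by
    refine (hX (U \ T) subset_rfl).trans (Finset.card_le_card fun u hu => ?_)
    rw [mem_sourceBoundary] at hu
    by_contra h
    exact hu.2.1 (Finset.mem_sdiff.2 ⟨hu.1, h⟩)
  obtain ⟨y, hyU, hxy, hyS⟩ : ∃ y ∈ U, G.Adj x y ∧ y ∉ S := by
    by_contra! hcon
    have h1 := hX {x} (by simp [hxU, hxT])
    have h2 : sourceBoundary G U S {x} ⊆ S.erase x := by
      intro u hu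
      rw [mem_sourceBoundary] at hu
      obtain ⟨hu, hux, h⟩ := hu
      simp only [Finset.mem_singleton] at hux
      simp only [Finset.mem_singleton, exists_eq_left] at h
      exact Finset.mem_erase.2 ⟨hux, h.elim id (hcon u hu)⟩
    have h3 := Finset.card_le_card h2
    have h4 := Finset.card_erase_lt_of_mem hxS
    omega
  have hyx : y ≠ x := hxy.ne'
  have hlt : (U.erase x).card < U.card := Finset.card_erase_lt_of_mem hxU
  by_cases hgood : ∀ X ⊆ U.erase x \ T,
      k ≤ (sourceBoundary G (U.erase x) (insert y (S.erase x)) X).card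
  · obtain ⟨Q, hQ⟩ := ih _ hlt (U.erase x) rfl (insert y (S.erase x)) T
      (by
        intro u hu
        simp only [Finset.mem_insert, Finset.mem_erase] at hu ⊢
        rcases hu with rfl | ⟨h, h'⟩
        · exact ⟨hyx, hyU⟩
        · exact ⟨h, hSU h'⟩)
      (fun u hu => Finset.mem_erase.2 ⟨fun h => hxT (h ▸ hu), hTU hu⟩)
      (by
        rw [Finset.card_insert_of_notMem (by simp [hyS]), Finset.card_erase_add_one hxS, hS])
      hgood
    exact hQ.cons hSU hxS hyS hxy
  push Not at hgood
  obtain ⟨X, hXsub, hXlt⟩ := hgood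
  have hXUT : X ⊆ U \ T := hXsub.trans (Finset.sdiff_subset_sdiff (Finset.erase_subset _ _) subset_rfl)
  have hxX : x ∉ X := fun h => by simpa using hXsub h
  have hXT : ∀ u ∈ X, u ∉ T := fun u hu => (Finset.mem_sdiff.1 (hXUT hu)).2
  have hXU : X ⊆ U := hXUT.trans Finset.sdiff_subset
  set R := sourceBoundary G U S X with hRdef
  have hkR : k ≤ R.card := hX X hXUT
  have hxR : x ∈ R := mem_sourceBoundary.2 ⟨hxU, hxX, Or.inl hxS⟩
  have hsub : R.erase x ⊆ sourceBoundary G (U.erase x) (insert y (S.erase x)) X := by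
    intro u hu
    obtain ⟨hux, hu⟩ := Finset.mem_erase.1 hu
    obtain ⟨hu1, hu2, hu3⟩ := mem_sourceBoundary.1 hu
    refine mem_sourceBoundary.2 ⟨by simp [hux, hu1], hu2, hu3.imp_left fun h => ?_⟩
    simp [hux, h]
  have hRe := Finset.card_erase_add_one hxR
  have hle := Finset.card_le_card hsub
  have hRk : R.card = k := by omega
  have hXne : X.Nonempty := by
    by_contra hemp
    rw [Finset.not_nonempty_iff_eq_empty] at hemp
    have : insert y (R.erase x) ⊆ sourceBoundary G (U.erase x) (insert y (S.erase x)) X := by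
      refine Finset.insert_subset ?_ hsub
      exact mem_sourceBoundary.2 ⟨by simp [hyx, hyU], by simp [hemp], by simp⟩
    have h1 := Finset.card_le_card this
    have h2 : y ∉ R.erase x := by
      intro h
      have := (mem_sourceBoundary.1 (Finset.mem_of_mem_erase h)).2.2
      simp [hemp, hyS] at this
    rw [Finset.card_insert_of_notMem h2] at h1
    omega
  have hRU : R ⊆ U := fun u hu => (mem_sourceBoundary.1 hu).1
  have hRX : ∀ u ∈ R, u ∉ X := fun u hu => (mem_sourceBoundary.1 hu).2.1
  have hne : X ∪ R ≠ U := by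
    intro h
    have hTR : T ⊆ R := by
      intro u hu
      have : u ∈ X ∪ R := h ▸ hTU hu
      exact (Finset.mem_union.1 this).resolve_left fun h' => hXT u h' hu
    have := Finset.eq_of_subset_of_card_le hTR (by omega)
    exact hxT (this ▸ hxR)
  have hlt₁ : (X ∪ R).card < U.card :=
    Finset.card_lt_card ((Finset.union_subset hXU hRU).ssubset_of_ne hne)
  have hlt₂ : (U \ X).card < U.card := by
    rw [Finset.card_sdiff_of_subset hXU]
    have := hXne.card_pos
    have := Finset.card_le_card hXU
    omega
  obtain ⟨Q₁, hQ₁⟩ := ih _ hlt₁ (X ∪ R) rfl S R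
    (by
      intro s hs
      by_cases h : s ∈ X
      · simp [h]
      · exact Finset.mem_union_right _ (mem_sourceBoundary.2 ⟨hSU hs, h, Or.inl hs⟩))
    Finset.subset_union_right hS
    (by
      intro Y hY
      have hYX : Y ⊆ X := fun u hu => by
        have := hY hu
        simp only [Finset.mem_sdiff, Finset.mem_union] at this
        tauto
      refine (hX Y (hYX.trans hXUT)).trans (Finset.card_le_card fun u hu => ?_)
      obtain ⟨hu1, hu2, hu3⟩ := mem_sourceBoundary.1 hu
      refine mem_sourceBoundary.2 ⟨?_, hu2, hu3⟩
      by_cases h : u ∈ X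
      · simp [h]
      · exact Finset.mem_union_right _ (mem_sourceBoundary.2
          ⟨hu1, h, hu3.imp_right fun ⟨a, ha, h⟩ => ⟨a, hYX ha, h⟩⟩))
  obtain ⟨Q₂, hQ₂⟩ := ih _ hlt₂ (U \ X) rfl R T
    (fun u hu => Finset.mem_sdiff.2 ⟨hRU hu, hRX u hu⟩)
    (fun u hu => Finset.mem_sdiff.2 ⟨hTU hu, fun h => hXT u h hu⟩) hRk
    (by
      intro Y hY
      have hY' : ∀ u ∈ Y, u ∈ U ∧ u ∉ X ∧ u ∉ T := fun u hu => by
        have := hY hu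
        simp only [Finset.mem_sdiff] at this
        tauto
      refine (hX (X ∪ Y) (Finset.union_subset hXUT fun u hu => ?_)).trans
        (Finset.card_le_card fun u hu => ?_)
      · exact Finset.mem_sdiff.2 ⟨(hY' u hu).1, (hY' u hu).2.2⟩
      · obtain ⟨hu1, hu2, hu3⟩ := mem_sourceBoundary.1 hu
        simp only [Finset.mem_union, not_or] at hu2
        refine mem_sourceBoundary.2 ⟨by simp [hu1, hu2.1], hu2.2, ?_⟩
        rcases hu3 with h | ⟨a, ha, h⟩
        · exact Or.inl (mem_sourceBoundary.2 ⟨hu1, hu2.1, Or.inl h⟩)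
        · rcases Finset.mem_union.1 ha with ha | ha
          · exact Or.inl (mem_sourceBoundary.2 ⟨hu1, hu2.1, Or.inr ⟨a, ha, h⟩⟩)
          · exact Or.inr ⟨a, ha, h⟩)
  refine hQ₁.append hQ₂ (by omega) (Finset.union_subset hXU hRU) Finset.sdiff_subset ?_
  intro u hu
  simp only [Finset.mem_inter, Finset.mem_union, Finset.mem_sdiff] at hu
  tauto

lemma exists_fin_injective_mem_finset {ι : Type*} {J : Finset ι} {n : ℕ} (h : n ≤ J.card) :
    ∃ f : Fin n → ι, Function.Injective f ∧ ∀ i, f i ∈ J :=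
  ⟨fun i => (J.equivFin.symm (Fin.castLE h i) : ι),
    fun _ _ hij => Fin.castLE_injective h (J.equivFin.symm.injective (Subtype.ext hij)),
    fun i => (J.equivFin.symm (Fin.castLE h i)).2⟩

lemma connected_induce_singleton {V : Type*} (G : SimpleGraph V) (v : V) :
    (G.induce {v}).Connected := by
  have : Subsingleton ({v} : Set V) := inferInstance
  exact ⟨.of_subsingleton⟩

lemma isMinorOf_completeBipartiteGraph {V ι : Type*} {G : SimpleGraph V} {J : Finset ι}
    {Q : ι → Set V} {M : Finset V} {t m : ℕ} (hconn : ∀ j ∈ J, (G.induce (Q j)).Connected)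
    (hdisj : ∀ i ∈ J, ∀ j ∈ J, i ≠ j → Disjoint (Q i) (Q j))
    (hM : ∀ x ∈ M, ∀ j ∈ J, x ∉ Q j) (hadj : ∀ x ∈ M, ∀ j ∈ J, ∃ u ∈ Q j, G.Adj u x)
    (ht : t ≤ J.card) (hm : m ≤ M.card) :
    IsMinorOf (completeBipartiteGraph (Fin t) (Fin m)) G := by
  obtain ⟨f, hf, hfJ⟩ := exists_fin_injective_mem_finset ht
  obtain ⟨g, hg, hgM⟩ := exists_fin_injective_mem_finset hm
  have hc : ∀ w, (G.induce (Sum.elim (fun i => Q (f i)) (fun j => {g j}) w)).Connected := by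
    rintro (i | j)
    · exact hconn _ (hfJ i)
    · exact connected_induce_singleton G _
  refine ⟨Sum.elim (fun i => Q (f i)) (fun j => {g j}), ?_, hc, ?_, ?_⟩
  · intro w
    exact Set.nonempty_coe_sort.1 (hc w).nonempty
  · rintro (i | i) (j | j) hij
    · exact hdisj _ (hfJ i) _ (hfJ j) fun h => hij (by rw [hf h])
    · simpa using hM _ (hgM j) _ (hfJ i)
    · simpa using hM _ (hgM i) _ (hfJ j)
    · simpa using fun h => hij (by rw [hg h])
  · rintro (i | i) (j | j) hij
    · simp at hij
    · obtain ⟨u, hu, h⟩ := hadj _ (hgM j) _ (hfJ i)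
      exact ⟨u, hu, g j, rfl, h⟩
    · obtain ⟨u, hu, h⟩ := hadj _ (hgM i) _ (hfJ j)
      exact ⟨g i, rfl, u, hu, h.symm⟩
    · simp at hij

lemma connected_induce_image_Icc {V : Type*} {G : SimpleGraph V} {f : ℕ → V} {a b : ℕ}
    (hab : a ≤ b) (hf : ∀ i, a ≤ i → i < b → G.Adj (f i) (f (i + 1))) :
    (G.induce (f '' Set.Icc a b)).Connected := by
  induction b, hab using Nat.le_induction with
  | base =>
    rw [Set.Icc_self, Set.image_singleton]
    exact connected_induce_singleton G (f a)
  | succ b hb ih =>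
    have : f '' Set.Icc a (b + 1) = f '' Set.Icc a b ∪ {f (b + 1)} := by
      rw [← Set.image_singleton, ← Set.image_union]
      congr 1
      ext i
      simp only [Set.mem_Icc, Set.mem_union, Set.mem_singleton_iff]
      omega
    rw [this]
    exact connected_induce_union (v := f b) (w := f (b + 1))
      (ih fun i h h' => hf i h (by omega)).preconnected
      (connected_induce_singleton G _).preconnected ⟨b, ⟨hb, le_rfl⟩, rfl⟩ rfl
      (hf b hb (by omega))

lemma isMinorOf_IplusP {V ι : Type*} {G : SimpleGraph V} {J : Finset ι}
    {Q : ι → Set V} {M : Finset V} {n m : ℕ} (hconn : ∀ j ∈ J, (G.induce (Q j)).Connected)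
    (hdisj : ∀ i ∈ J, ∀ j ∈ J, i ≠ j → Disjoint (Q i) (Q j))
    (hadj : ∀ x ∈ M, ∀ j ∈ J, ∃ u ∈ Q j, G.Adj u x)
    {a b : V} {p : G.Walk a b} (hp : p.IsPath) (hpQ : ∀ u ∈ p.support, ∀ j ∈ J, u ∉ Q j)
    (hMp : ∀ x ∈ M, x ∈ p.support) (hn : n ≤ J.card) (hm : m ≤ M.card) :
    IsMinorOf (IplusP n m) G := by
  classical
  obtain ⟨f, hf, hfJ⟩ := exists_fin_injective_mem_finset hn
  set I : Finset ℕ := (Finset.range (p.length + 1)).filter fun i => p.getVert i ∈ M with hI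
  have hMI : M ⊆ I.image p.getVert := by
    intro x hx
    obtain ⟨i, rfl, hi⟩ := Walk.mem_support_iff_exists_getVert.1 (hMp x hx)
    exact Finset.mem_image.2 ⟨i, by simp [hI, hx]; omega, rfl⟩
  have hIm : m ≤ I.card := hm.trans ((Finset.card_le_card hMI).trans Finset.card_image_le)
  obtain ⟨I', hI'I, hI'm⟩ := Finset.exists_subset_card_eq hIm
  set e := I'.orderEmbOfFin hI'm with he
  have heI : ∀ j, e j ≤ p.length ∧ p.getVert (e j) ∈ M := by
    intro j
    have := hI'I (Finset.orderEmbOfFin_mem I' hI'm j)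
    simp only [hI, Finset.mem_filter, Finset.mem_range] at this
    exact ⟨Nat.lt_succ_iff.1 this.1, this.2⟩
  set g : Fin m → ℕ := fun j => if h : (j : ℕ) + 1 < m then e ⟨j + 1, h⟩ - 1 else e j with hg
  have heg : ∀ j, e j ≤ g j := by
    intro j
    simp only [hg]
    split_ifs with h
    · have : e j < e ⟨j + 1, h⟩ := e.strictMono (Fin.mk_lt_mk.2 (Nat.lt_succ_self _))
      omega
    · exact le_rfl
  have hgl : ∀ j, g j ≤ p.length := by
    intro j
    simp only [hg]
    split_ifs with h
    · exact (Nat.sub_le _ _).trans (heI _).1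
    · exact (heI j).1
  have hge : ∀ i j : Fin m, i < j → g i < e j := by
    intro i j hij
    have hij' : (i : ℕ) + 1 ≤ j := hij
    have h : (i : ℕ) + 1 < m := hij'.trans_lt j.2
    have h1 : e i < e ⟨i + 1, h⟩ := e.strictMono (Fin.mk_lt_mk.2 (Nat.lt_succ_self _))
    have h2 : e ⟨i + 1, h⟩ ≤ e j := e.monotone (Fin.mk_le_mk.2 hij')
    simp only [hg, h, dif_pos]
    omega
  set μ : Fin n ⊕ Fin m → Set V :=
    Sum.elim (fun i => Q (f i)) (fun j => p.getVert '' Set.Icc (e j) (g j)) with hμ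
  have hc : ∀ w, (G.induce (μ w)).Connected := by
    rintro (i | j)
    · exact hconn _ (hfJ i)
    · exact connected_induce_image_Icc (heg j) fun i _ hi =>
        p.adj_getVert_succ (hi.trans_le (hgl j))
  have hQμ : ∀ i j, Disjoint (Q (f i)) (p.getVert '' Set.Icc (e j) (g j)) := by
    intro i j
    rw [Set.disjoint_right]
    rintro _ ⟨l, hl, rfl⟩
    exact hpQ _ (Walk.mem_support_iff_exists_getVert.2 ⟨l, rfl, hl.2.trans (hgl j)⟩) _ (hfJ i)
  have hμμ : ∀ i j : Fin m, i < j →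
      Disjoint (p.getVert '' Set.Icc (e i) (g i)) (p.getVert '' Set.Icc (e j) (g j)) := by
    intro i j hij
    rw [Set.disjoint_left]
    rintro _ ⟨l, hl, rfl⟩ ⟨l', hl', h⟩
    have := hp.getVert_injOn (hl'.2.trans (hgl j)) (hl.2.trans (hgl i)) h
    have := hge i j hij
    have := hl.2
    have := hl'.1
    omega
  have hsymm : ∀ i j, ∃ u ∈ μ (Sum.inl i), ∃ v ∈ μ (Sum.inr j), G.Adj u v := by
    intro i j
    obtain ⟨u, hu, h⟩ := hadj _ (heI j).2 _ (hfJ i)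
    exact ⟨u, hu, _, ⟨e j, ⟨le_rfl, heg j⟩, rfl⟩, h⟩
  have hpath : ∀ i j : Fin m, (i : ℕ) + 1 = j →
      ∃ u ∈ μ (Sum.inr i), ∃ v ∈ μ (Sum.inr j), G.Adj u v := by
    intro i j hij
    have h : (i : ℕ) + 1 < m := hij ▸ j.2
    have hj : j = ⟨i + 1, h⟩ := Fin.ext hij.symm
    have hgi : g i + 1 = e j := by
      have h1 : e i < e ⟨i + 1, h⟩ := e.strictMono (Fin.mk_lt_mk.2 (Nat.lt_succ_self _))
      simp only [hg, h, dif_pos, hj]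
      omega
    refine ⟨_, ⟨g i, ⟨heg i, le_rfl⟩, rfl⟩, _, ⟨e j, ⟨le_rfl, heg j⟩, rfl⟩, ?_⟩
    rw [← hgi]
    exact p.adj_getVert_succ (by have := (heI j).1; omega)
  refine ⟨μ, fun w => Set.nonempty_coe_sort.1 (hc w).nonempty, hc, ?_, ?_⟩
  · rintro (i | i) (j | j) hij
    · exact hdisj _ (hfJ i) _ (hfJ j) fun h => hij (by rw [hf h])
    · exact hQμ i j
    · exact (hQμ j i).symm
    · rcases lt_or_gt_of_ne (fun h => hij (by rw [h]) : i ≠ j) with h | h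
      · exact hμμ i j h
      · exact (hμμ j i h).symm
  · intro u v huv
    have hrel : ∀ u v, ((∃ i j, u = Sum.inl i ∧ v = Sum.inr j) ∨
        (∃ i j : Fin m, u = Sum.inr i ∧ v = Sum.inr j ∧ (i : ℕ) + 1 = (j : ℕ))) →
        ∃ x ∈ μ u, ∃ y ∈ μ v, G.Adj x y := by
      rintro _ _ (⟨i, j, rfl, rfl⟩ | ⟨i, j, rfl, rfl, h⟩)
      · exact hsymm i j
      · exact hpath i j h
    rcases ((SimpleGraph.fromRel_adj _ _ _).1 huv).2 with h | h
    · exact hrel _ _ h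
    · obtain ⟨x, hx, y, hy, hxy⟩ := hrel _ _ h
      exact ⟨y, hy, x, hx, hxy.symm⟩

/-- The set of vertices outside `A` with a neighbor in `A`. -/
noncomputable def outerBoundary (G : SimpleGraph V) (A : Finset V) : Finset V :=
  Finset.univ.filter fun u => u ∉ A ∧ ∃ a ∈ A, G.Adj a u

lemma mem_outerBoundary {G : SimpleGraph V} {A : Finset V} {u : V} :
    u ∈ outerBoundary G A ↔ u ∉ A ∧ ∃ a ∈ A, G.Adj a u := by
  simp [outerBoundary]

lemma outerBoundary_inter_subset {G : SimpleGraph V} {A B C : Finset V} (hAB : A ⊆ B)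
    (hBC : B ⊆ C) : outerBoundary G A ∩ outerBoundary G C ⊆ outerBoundary G B := by
  intro u hu
  simp only [Finset.mem_inter, mem_outerBoundary] at hu ⊢
  obtain ⟨⟨-, a, ha, h⟩, hC, -⟩ := hu
  exact ⟨fun h => hC (hBC h), a, hAB ha, h⟩

/-- The neighbors of `v` outside `A`. -/
noncomputable def outerNeighbors (G : SimpleGraph V) (A : Finset V) (v : V) : Finset V :=
  Finset.univ.filter fun u => u ∉ A ∧ G.Adj v u

lemma mem_outerNeighbors {G : SimpleGraph V} {A : Finset V} {u v : V} :
    u ∈ outerNeighbors G A v ↔ u ∉ A ∧ G.Adj v u := by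
  simp [outerNeighbors]

/-- A length of chains of sets with boundaries of size at most `k` that guarantees a linked
subchain of length `M`. -/
def linkedChainBound (M : ℕ) : ℕ → ℕ
  | 0 => M
  | k + 1 => (2 * linkedChainBound M k + 1) * M

lemma exists_linked_chain (G : SimpleGraph V) {M : ℕ} (hM : 0 < M) : ∀ (k : ℕ) (c : ℕ → Finset V),
    (∀ i j, i < j → j ≤ linkedChainBound M k → c i ⊂ c j) →
    (∀ i ≤ linkedChainBound M k, (outerBoundary G (c i)).card ≤ k) →
    ∃ k' ≤ k, ∃ B : ℕ → Finset V, (∀ i j, i < j → j ≤ M → B i ⊂ B j) ∧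
      B M ⊆ c (linkedChainBound M k) ∧ (∀ i ≤ M, (outerBoundary G (B i)).card = k') ∧
      ∀ X, B 0 ⊆ X → X ⊆ B M → k' ≤ (outerBoundary G X).card := by
  intro k
  induction k with
  | zero =>
    intro c hc hk
    exact ⟨0, le_rfl, c, hc, subset_rfl, fun i hi => Nat.le_zero.1 (hk i hi), fun _ _ _ => Nat.zero_le _⟩
  | succ k ih =>
    intro c hc hk
    set L := linkedChainBound M k with hL
    have hL' : linkedChainBound M (k + 1) = (2 * L + 1) * M := rfl
    rw [hL'] at hc hk ⊢
    have hmono : ∀ i j, i ≤ j → j ≤ (2 * L + 1) * M → c i ⊆ c j := by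
      intro i j hij hj
      rcases hij.eq_or_lt with rfl | h
      · exact subset_rfl
      · exact (hc i j h hj).subset
    have hmul : ∀ {i j : ℕ}, i ≤ j → i * M ≤ j * M := fun h => Nat.mul_le_mul_right M h
    by_cases hex : ∃ j ≤ 2 * L, ∀ X, c (j * M) ⊆ X → X ⊆ c (j * M + M) →
        k + 1 ≤ (outerBoundary G X).card
    · obtain ⟨j, hj, hX⟩ := hex
      have hjM : j * M + M ≤ (2 * L + 1) * M := by
        have := hmul (show j + 1 ≤ 2 * L + 1 by omega)
        rwa [Nat.add_one_mul] at this
      refine ⟨k + 1, le_rfl, fun i => c (j * M + i), fun i i' h h' => hc _ _ (by omega) (by omega),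
        hmono _ _ hjM le_rfl, fun i hi => ?_, fun X h h' => hX X (by simpa using h) h'⟩
      exact le_antisymm (hk _ (by omega)) (hX _ (hmono _ _ (by omega) (by omega))
        (hmono _ _ (by omega) (by omega)))
    · push Not at hex
      have : ∀ j, ∃ X, j ≤ 2 * L → c (j * M) ⊆ X ∧ X ⊆ c (j * M + M) ∧
          (outerBoundary G X).card < k + 1 := by
        intro j
        by_cases hj : j ≤ 2 * L
        · obtain ⟨X, h⟩ := hex j hj
          exact ⟨X, fun _ => h⟩
        · exact ⟨∅, fun h => absurd h hj⟩
      choose X hX using this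
      obtain ⟨k', hk', B, h1, h2, h3, h4⟩ := ih (fun i => X (2 * i))
        (by
          intro i j hij hj
          have a1 := (hX (2 * i) (by omega)).2.1
          have a2 := (hX (2 * j) (by omega)).1
          have b1 : (2 * i + 1 + 1) * M ≤ 2 * j * M := hmul (by omega)
          have b2 : 2 * j * M ≤ (2 * L + 1) * M := hmul (by omega)
          have a3 := hc (2 * i * M + M) (2 * j * M) (by
            rw [Nat.add_one_mul, Nat.add_one_mul] at b1; omega) b2
          exact (a1.trans_ssubset a3).trans_subset a2)
        (fun i hi => Nat.lt_succ_iff.1 (hX (2 * i) (by omega)).2.2)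
      refine ⟨k', hk'.trans (Nat.le_succ k), B, h1, h2.trans ?_, h3, h4⟩
      refine (hX (2 * L) le_rfl).2.1.trans (hmono _ _ (le_of_eq ?_) le_rfl)
      rw [Nat.add_one_mul (2 * L)]

lemma exists_consistent_window (G : SimpleGraph V) (k : ℕ) (c : ℕ → Finset V) {n : ℕ}
    (hc : ∀ i j, i ≤ j → j ≤ n → c i ⊆ c j) (hk : ∀ i ≤ n, (outerBoundary G (c i)).card ≤ k) :
    ∀ d a, a + 3 ^ d ≤ n →
      k < (outerBoundary G (c a) ∩ outerBoundary G (c (a + 3 ^ d))).card + d →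
      ∃ i j l h, a ≤ i ∧ i < j ∧ j < l ∧ l < h ∧ h ≤ a + 3 ^ d ∧
        outerBoundary G (c i) ∩ outerBoundary G (c j) ⊆
          outerBoundary G (c i) ∩ outerBoundary G (c h) ∧
        outerBoundary G (c j) ∩ outerBoundary G (c l) ⊆
          outerBoundary G (c i) ∩ outerBoundary G (c h) ∧
        outerBoundary G (c l) ∩ outerBoundary G (c h) ⊆
          outerBoundary G (c i) ∩ outerBoundary G (c h) := by
  intro d
  induction d with
  | zero =>
    intro a ha hlt
    have := Finset.card_le_card (Finset.inter_subset_left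
      (s₁ := outerBoundary G (c a)) (s₂ := outerBoundary G (c (a + 3 ^ 0))))
    have := hk a (by omega)
    omega
  | succ d ih =>
    intro a ha hlt
    have hpow : 3 ^ (d + 1) = 3 ^ d + 3 ^ d + 3 ^ d := by ring
    have hpos : 0 < 3 ^ d := by positivity
    rw [hpow] at ha hlt ⊢
    set p := 3 ^ d with hp
    have sub : ∀ x y, a ≤ x → x ≤ y → y ≤ a + (p + p + p) →
        outerBoundary G (c a) ∩ outerBoundary G (c (a + (p + p + p))) ⊆
          outerBoundary G (c x) ∩ outerBoundary G (c y) := by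
      intro x y hax hxy hy
      exact Finset.subset_inter
        (outerBoundary_inter_subset (hc _ _ hax (by omega)) (hc _ _ (by omega) ha))
        (outerBoundary_inter_subset (hc _ _ (by omega) (by omega)) (hc _ _ (by omega) ha))
    have hrec : ∀ x, a ≤ x → x + p ≤ a + (p + p + p) →
        ¬ outerBoundary G (c x) ∩ outerBoundary G (c (x + p)) ⊆
          outerBoundary G (c a) ∩ outerBoundary G (c (a + (p + p + p))) →
        k < (outerBoundary G (c x) ∩ outerBoundary G (c (x + p))).card + d := by
      intro x hax hx hnot
      have := Finset.card_lt_card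
        ((sub x (x + p) hax (by omega) hx).ssubset_of_not_subset hnot)
      omega
    by_cases h1 : outerBoundary G (c a) ∩ outerBoundary G (c (a + p)) ⊆
        outerBoundary G (c a) ∩ outerBoundary G (c (a + (p + p + p)))
    · by_cases h2 : outerBoundary G (c (a + p)) ∩ outerBoundary G (c (a + p + p)) ⊆
        outerBoundary G (c a) ∩ outerBoundary G (c (a + (p + p + p)))
      · by_cases h3 : outerBoundary G (c (a + p + p)) ∩ outerBoundary G (c (a + p + p + p)) ⊆
          outerBoundary G (c a) ∩ outerBoundary G (c (a + (p + p + p)))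
        · have e : a + (p + p + p) = a + p + p + p := by ring
          rw [e] at h1 h2 h3 ⊢
          exact ⟨a, a + p, a + p + p, a + p + p + p, le_rfl, by omega, by omega, by omega,
            le_rfl, h1, h2, h3⟩
        · obtain ⟨i, j, l, h, b1, b2, b3, b4, b5, b6⟩ := ih (a + p + p) (by omega)
            (hrec _ (by omega) (by omega) h3)
          exact ⟨i, j, l, h, by omega, b2, b3, b4, by omega, b6⟩
      · obtain ⟨i, j, l, h, b1, b2, b3, b4, b5, b6⟩ := ih (a + p) (by omega)
          (hrec _ (by omega) (by omega) h2)
        exact ⟨i, j, l, h, by omega, b2, b3, b4, by omega, b6⟩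
    · obtain ⟨i, j, l, h, b1, b2, b3, b4, b5, b6⟩ := ih a (by omega)
        (hrec _ (by omega) (by omega) h1)
      exact ⟨i, j, l, h, by omega, b2, b3, b4, by omega, b6⟩

/-- In a consistent window `A ⊂ B ⊂ C ⊂ D`, a vertex witnessing that the part strictly between
`A` and `D` is not an island has its outer neighbors on one side. -/
lemma exists_vertex_of_window {G : SimpleGraph V} {t : ℕ} {A B C D : Finset V}
    (hAB : A ⊆ B) (hBC : B ⊂ C) (hCD : C ⊆ D)
    (h1 : outerBoundary G A ∩ outerBoundary G B ⊆ outerBoundary G A ∩ outerBoundary G D)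
    (h2 : outerBoundary G B ∩ outerBoundary G C ⊆ outerBoundary G A ∩ outerBoundary G D)
    (h3 : outerBoundary G C ∩ outerBoundary G D ⊆ outerBoundary G A ∩ outerBoundary G D)
    (hisl : ∀ W : Finset V, W.Nonempty → W ⊆ D → ∃ v ∈ W, t ≤ (outerNeighbors G W v).card) :
    ∃ v ∈ D, v ∉ A ∧ ∃ N : Finset V, t ≤ N.card ∧ (∀ u ∈ N, G.Adj u v) ∧
      (N ⊆ outerBoundary G A ∨ N ⊆ outerBoundary G D) := by
  have hBD : B ⊆ D := hBC.subset.trans hCD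
  set W := D \ (A ∪ outerBoundary G A) with hW
  have hmemW : ∀ u, u ∈ W ↔ u ∈ D ∧ u ∉ A ∧ u ∉ outerBoundary G A := by simp [hW]
  have hne : W.Nonempty := by
    obtain ⟨x, hxC, hxB⟩ := Finset.exists_of_ssubset hBC
    refine ⟨x, (hmemW x).2 ⟨hCD hxC, fun h => hxB (hAB h), fun h => ?_⟩⟩
    have : x ∈ outerBoundary G B := by
      obtain ⟨-, a, ha, h⟩ := mem_outerBoundary.1 h
      exact mem_outerBoundary.2 ⟨hxB, a, hAB ha, h⟩
    have := h1 (Finset.mem_inter.2 ⟨h, this⟩)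
    exact (mem_outerBoundary.1 (Finset.mem_inter.1 this).2).1 (hCD hxC)
  obtain ⟨v, hv, ht⟩ := hisl W hne fun u hu => ((hmemW u).1 hu).1
  obtain ⟨hvD, hvA, hvNA⟩ := (hmemW v).1 hv
  have hside : ∀ u ∈ outerNeighbors G W v, u ∈ outerBoundary G A ∨ u ∈ outerBoundary G D := by
    intro u hu
    obtain ⟨huW, hadj⟩ := mem_outerNeighbors.1 hu
    by_cases huD : u ∈ D
    · left
      by_contra hnA
      refine huW ((hmemW u).2 ⟨huD, fun huA => hvNA ?_, hnA⟩)
      exact mem_outerBoundary.2 ⟨hvA, u, huA, hadj.symm⟩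
    · exact Or.inr (mem_outerBoundary.2 ⟨huD, v, hvD, hadj⟩)
  refine ⟨v, hvD, hvA, _, ht, fun u hu => (mem_outerNeighbors.1 hu).2.symm, ?_⟩
  -- the right boundary cannot be reached from an intermediate set meeting it only in `∂A`
  have hright : ∀ {E : Finset V}, E ⊆ D → v ∈ E →
      outerBoundary G E ∩ outerBoundary G D ⊆ outerBoundary G A ∩ outerBoundary G D →
      outerNeighbors G W v ⊆ outerBoundary G A := by
    intro E hED hvE hE u hu
    refine (hside u hu).elim id fun huD => ?_
    have huE : u ∈ outerBoundary G E := mem_outerBoundary.2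
      ⟨fun h => (mem_outerBoundary.1 huD).1 (hED h), v, hvE, (mem_outerNeighbors.1 hu).2⟩
    exact (Finset.mem_inter.1 (hE (Finset.mem_inter.2 ⟨huE, huD⟩))).1
  by_cases hvC : v ∈ C
  · exact Or.inl (hright hCD hvC h3)
  · right
    intro u hu
    refine (hside u hu).elim (fun huA => ?_) id
    have hadj := (mem_outerNeighbors.1 hu).2
    by_cases huB : u ∈ B
    · have hv1 : v ∈ outerBoundary G B :=
        mem_outerBoundary.2 ⟨fun h => hvC (hBC.subset h), u, huB, hadj.symm⟩
      have hv2 : v ∈ outerBoundary G C :=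
        mem_outerBoundary.2 ⟨hvC, u, hBC.subset huB, hadj.symm⟩
      exact absurd (Finset.mem_inter.1 (h2 (Finset.mem_inter.2 ⟨hv1, hv2⟩))).1 hvNA
    · obtain ⟨-, a, ha, h⟩ := mem_outerBoundary.1 huA
      have huB' : u ∈ outerBoundary G B := mem_outerBoundary.2 ⟨huB, a, hAB ha, h⟩
      exact (Finset.mem_inter.1 (h1 (Finset.mem_inter.2 ⟨huA, huB'⟩))).2

/-- Between two sets `A ⊆ B` such that all sets in between have boundary at least as large as that
of `A`, there are disjoint paths, one from each vertex of the boundary of `A`, that meet the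
boundary of each set in between. -/
lemma exists_paths_between (G : SimpleGraph V) {A B : Finset V} (hAB : A ⊆ B)
    (hX : ∀ X, A ⊆ X → X ⊆ B → (outerBoundary G A).card ≤ (outerBoundary G X).card) :
    ∃ Q : V → Finset V,
      (∀ s ∈ outerBoundary G A, ∃ e, ∃ p : G.Walk s e, p.IsPath ∧ ∀ u, u ∈ p.support ↔ u ∈ Q s) ∧
      (∀ s ∈ outerBoundary G A, ∀ s' ∈ outerBoundary G A, s ≠ s' → Disjoint (Q s) (Q s')) ∧
      ∀ X, A ⊆ X → X ⊆ B → ∀ s ∈ outerBoundary G A, ∃ u ∈ Q s, u ∈ outerBoundary G X := by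
  obtain ⟨Q₀, hQ₀⟩ := exists_isLinkage G _
    (outerBoundary G A ∪ outerBoundary G B ∪ (B \ A)) (outerBoundary G A) (outerBoundary G B)
    (by intro u hu; simp [hu]) (by intro u hu; simp [hu]) rfl
    (by
      intro X hXU
      have hXB : X ⊆ B := by
        intro u hu
        have := hXU hu
        simp only [Finset.mem_sdiff, Finset.mem_union] at this
        obtain ⟨(h | h) | h, hnB⟩ := this
        · obtain ⟨-, a, ha, h⟩ := mem_outerBoundary.1 h
          by_contra huB
          exact hnB (mem_outerBoundary.2 ⟨huB, a, hAB ha, h⟩)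
        · exact absurd h hnB
        · exact h.1
      refine (hX (A ∪ X) Finset.subset_union_left (Finset.union_subset hAB hXB)).trans
        (Finset.card_le_card fun u hu => ?_)
      obtain ⟨hu, a, ha, h⟩ := mem_outerBoundary.1 hu
      simp only [Finset.mem_union, not_or] at hu
      rw [mem_sourceBoundary]
      rcases Finset.mem_union.1 ha with ha | ha
      · have : u ∈ outerBoundary G A := mem_outerBoundary.2 ⟨hu.1, a, ha, h⟩
        exact ⟨by simp [this], hu.2, Or.inl this⟩
      · refine ⟨?_, hu.2, Or.inr ⟨a, ha, h⟩⟩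
        by_cases huB : u ∈ B
        · simp [huB, hu.1]
        · have : u ∈ outerBoundary G B := mem_outerBoundary.2 ⟨huB, a, hXB ha, h⟩
          simp [this])
  obtain ⟨Q, h1, h2⟩ := hQ₀.exists_isPath
  refine ⟨Q, fun s hs => ?_, h2, fun X hAX hXB s hs => ?_⟩
  · obtain ⟨e, -, p, hp⟩ := h1 s hs
    exact ⟨e, p, hp⟩
  · obtain ⟨e, he, p, -, hp⟩ := h1 s hs
    by_cases hsX : s ∈ X
    · obtain ⟨d, hd, hd1, hd2⟩ := p.exists_boundary_dart (X : Set V) hsX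
        fun h => (mem_outerBoundary.1 he).1 (hXB h)
      exact ⟨d.snd, (hp _).1 (p.dart_snd_mem_support_of_mem_darts hd),
        mem_outerBoundary.2 ⟨hd2, d.fst, hd1, d.adj⟩⟩
    · obtain ⟨-, a, ha, h⟩ := mem_outerBoundary.1 hs
      exact ⟨s, (hp _).1 p.start_mem_support, mem_outerBoundary.2 ⟨hsX, a, hAX ha, h⟩⟩

/-- If disjoint sets `Q s` all meet a set `R` that is not larger than their number, then
distinct elements of `R` lie in distinct `Q s`. -/
lemma card_le_card_filter_of_disjoint {V : Type*} {S R D : Finset V} {Q : V → Finset V}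
    (hQ : ∀ s ∈ S, ∀ s' ∈ S, s ≠ s' → Disjoint (Q s) (Q s'))
    (hR : ∀ s ∈ S, ∃ u ∈ Q s, u ∈ R) (hcard : R.card ≤ S.card) (hD : D ⊆ R) :
    D.card ≤ (S.filter fun s => ∃ u ∈ D, u ∈ Q s).card := by
  have : ∀ s, ∃ u, s ∈ S → u ∈ Q s ∧ u ∈ R := by
    intro s
    by_cases hs : s ∈ S
    · obtain ⟨u, hu⟩ := hR s hs
      exact ⟨u, fun _ => hu⟩
    · exact ⟨s, fun h => absurd h hs⟩
  choose f hf using this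
  have hsub : S.image f ⊆ R := by
    intro u hu
    obtain ⟨s, hs, rfl⟩ := Finset.mem_image.1 hu
    exact (hf s hs).2
  have hinj : Set.InjOn f S := by
    intro s hs s' hs' h
    by_contra hne
    exact Finset.disjoint_left.1 (hQ s hs s' hs' hne) (hf s hs).1 (h ▸ (hf s' hs').1)
  have heq := Finset.eq_of_subset_of_card_le hsub (by rw [Finset.card_image_of_injOn hinj]; omega)
  refine (Finset.card_le_card fun u hu => ?_).trans (Finset.card_image_le (f := f))
  have : u ∈ S.image f := heq ▸ hD hu
  obtain ⟨s, hs, rfl⟩ := Finset.mem_image.1 this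
  exact Finset.mem_image_of_mem _ (Finset.mem_filter.2 ⟨hs, _, hu, (hf s hs).1⟩)

/-- The number of windows of a linked chain sufficient to find a forbidden minor. -/
def windowCount (m w : ℕ) : ℕ := 2 ^ (w + 1) * (w + 2) * m

lemma exists_minor_of_linked_chain [Nonempty V] {G : SimpleGraph V} {t m w k : ℕ} {B : ℕ → Finset V}
    (hm : 1 ≤ m) (hk : k ≤ w + 1)
    (hB : ∀ i j, i < j → j ≤ windowCount m w * 3 ^ (w + 2) → B i ⊂ B j)
    (hcard : ∀ i ≤ windowCount m w * 3 ^ (w + 2), (outerBoundary G (B i)).card = k)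
    (hX : ∀ X, B 0 ⊆ X → X ⊆ B (windowCount m w * 3 ^ (w + 2)) → k ≤ (outerBoundary G X).card)
    (hisl : ∀ W : Finset V, W.Nonempty → W ⊆ B (windowCount m w * 3 ^ (w + 2)) →
      ∃ v ∈ W, t ≤ (outerNeighbors G W v).card) :
    IsMinorOf (completeBipartiteGraph (Fin t) (Fin m)) G ∨ IsMinorOf (IplusP (t - 1) m) G := by
  set q := 3 ^ (w + 2) with hq
  set M := windowCount m w * q with hM
  have hmono : ∀ i j, i ≤ j → j ≤ M → B i ⊆ B j := by
    intro i j hij hj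
    rcases hij.eq_or_lt with rfl | h
    · exact subset_rfl
    · exact (hB i j h hj).subset
  set S := outerBoundary G (B 0) with hS
  have hSk : S.card = k := hcard 0 (Nat.zero_le _)
  obtain ⟨Q, hQp, hQd, hQX⟩ := exists_paths_between G (hmono 0 M (Nat.zero_le _) le_rfl)
    (by rw [← hS, hSk]; exact hX)
  rw [← hS] at hQp hQd hQX
  have hmul : ∀ {i j : ℕ}, i ≤ j → i * q ≤ j * q := fun h => Nat.mul_le_mul_right q h
  have hwin : ∀ b, ∃ v, b < windowCount m w → v ∈ B ((b + 1) * q) ∧ v ∉ B (b * q) ∧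
      t ≤ (S.filter fun s => ∃ u ∈ Q s, G.Adj u v).card := by
    intro b
    by_cases hb : b < windowCount m w
    swap
    · exact ⟨Classical.arbitrary V, fun h => absurd h hb⟩
    have hbM : b * q + q ≤ M := by
      have := hmul (Nat.succ_le_of_lt hb)
      rwa [Nat.succ_mul] at this
    obtain ⟨i, j, l, h, hi, hij, hjl, hlh, hh, c1, c2, c3⟩ :=
      exists_consistent_window G k B hmono (fun i hi => (hcard i hi).le) (w + 2) (b * q) hbM
        (by omega)
    rw [← hq] at hh
    obtain ⟨v, hvD, hvA, N, hNt, hNadj, hN⟩ := exists_vertex_of_window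
      (hmono i j hij.le (by omega)) (hB j l hjl (by omega)) (hmono l h hlh.le (by omega))
      c1 c2 c3 fun W hW hWh => hisl W hW (hWh.trans (hmono h M (by omega) le_rfl))
    obtain ⟨x, hx, hNx⟩ : ∃ x ≤ M, N ⊆ outerBoundary G (B x) := by
      rcases hN with hN | hN
      · exact ⟨i, by omega, hN⟩
      · exact ⟨h, by omega, hN⟩
    refine ⟨v, fun _ => ⟨?_, fun hv => hvA (hmono _ _ hi (by omega) hv), ?_⟩⟩
    · rw [Nat.add_one_mul]
      exact hmono _ _ hh hbM hvD
    · have := card_le_card_filter_of_disjoint hQd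
        (hQX (B x) (hmono _ _ (Nat.zero_le _) hx) (hmono _ _ hx le_rfl))
        (by rw [hcard x hx, hSk]) hNx
      refine hNt.trans (this.trans (Finset.card_le_card fun s hs => ?_))
      obtain ⟨hs, u, hu, huQ⟩ := Finset.mem_filter.1 hs
      exact Finset.mem_filter.2 ⟨hs, u, huQ, hNadj u hu⟩
  choose v hv using hwin
  have hvinj : Set.InjOn v (Finset.range (windowCount m w)) := by
    have key : ∀ b b', b < b' → b' < windowCount m w → v b ≠ v b' := by
      intro b b' hlt hb' heq
      have h1 := (hv b (hlt.trans hb')).1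
      refine (hv b' hb').2.1 (heq ▸ hmono _ _ (hmul hlt) (hmul hb'.le) h1)
    intro b hb b' hb' heq
    simp only [Finset.coe_range, Set.mem_Iio] at hb hb'
    rcases lt_trichotomy b b' with h | h | h
    · exact absurd heq (key b b' h hb')
    · exact h
    · exact absurd heq.symm (key b' b h hb)
  set J : ℕ → Finset V := fun b => S.filter fun s => ∃ u ∈ Q s, G.Adj u (v b) with hJ
  have howner : ∀ x : V, ∃ o ∈ Finset.insertNone S,
      (o = none → ∀ s ∈ S, x ∉ Q s) ∧ ∀ s, o = some s → x ∈ Q s := by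
    intro x
    by_cases h : ∃ s ∈ S, x ∈ Q s
    · obtain ⟨s, hs, hx⟩ := h
      exact ⟨some s, by simpa using hs, by simp, by rintro _ ⟨⟩; exact hx⟩
    · push Not at h
      exact ⟨none, by simp, fun _ => h, by simp⟩
  choose o hoS ho1 ho2 using howner
  obtain ⟨⟨J₀, o₀⟩, hJo, hfib⟩ := Finset.exists_le_card_fiber_of_mul_le_card_of_maps_to
    (s := Finset.range (windowCount m w)) (t := S.powerset ×ˢ Finset.insertNone S)
    (f := fun b => (J b, o (v b))) (n := m)
    (fun b _ => Finset.mem_product.2 ⟨Finset.mem_powerset.2 (Finset.filter_subset _ _), hoS _⟩)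
    ⟨(∅, none), by simp⟩
    (by
      rw [Finset.card_product, Finset.card_powerset, Finset.card_insertNone, Finset.card_range,
        hSk, windowCount]
      exact Nat.mul_le_mul_right m
        (Nat.mul_le_mul (Nat.pow_le_pow_right (by norm_num) hk) (by omega)))
  set F := (Finset.range (windowCount m w)).filter fun b => (J b, o (v b)) = (J₀, o₀) with hF
  set X := F.image v with hXdef
  have hXm : m ≤ X.card := by
    rwa [hXdef, Finset.card_image_of_injOn (hvinj.mono (Finset.coe_subset.2 (Finset.filter_subset _ _)))]
  have hXmem : ∀ x ∈ X, o x = o₀ ∧ t ≤ J₀.card ∧ ∀ s ∈ J₀, ∃ u ∈ (Q s : Set V), G.Adj u x := by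
    intro x hx
    obtain ⟨b, hb, rfl⟩ := Finset.mem_image.1 hx
    obtain ⟨hbr, h⟩ := Finset.mem_filter.1 hb
    obtain ⟨h1, h2⟩ := Prod.mk.inj h
    refine ⟨h2, h1 ▸ (hv b (Finset.mem_range.1 hbr)).2.2, fun s hs => ?_⟩
    exact (Finset.mem_filter.1 (h1 ▸ hs : s ∈ J b)).2
  have hJS : J₀ ⊆ S := Finset.mem_powerset.1 (Finset.mem_product.1 hJo).1
  have hoS₀ : o₀ ∈ Finset.insertNone S := (Finset.mem_product.1 hJo).2
  obtain ⟨x₀, hx₀⟩ : X.Nonempty := Finset.card_pos.1 (by omega)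
  have hJt : t ≤ J₀.card := (hXmem x₀ hx₀).2.1
  have hconn : ∀ s ∈ S, (G.induce (Q s : Set V)).Connected := by
    intro s hs
    obtain ⟨e, p, -, hp⟩ := hQp s hs
    have : (Q s : Set V) = {v | v ∈ p.support} := by
      ext u
      simp [hp u]
    rw [this]
    exact p.connected_induce_support
  have hdisj : ∀ s ∈ S, ∀ s' ∈ S, s ≠ s' → Disjoint (Q s : Set V) (Q s' : Set V) :=
    fun s hs s' hs' hne => Finset.disjoint_coe.2 (hQd s hs s' hs' hne)
  cases o₀ with
  | none =>
    exact Or.inl (isMinorOf_completeBipartiteGraph (J := J₀) (Q := fun s => (Q s : Set V)) (M := X)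
      (fun s hs => hconn s (hJS hs)) (fun s hs s' hs' => hdisj s (hJS hs) s' (hJS hs'))
      (fun x hx s hs => by simpa using ho1 x (hXmem x hx).1 s (hJS hs))
      (fun x hx => (hXmem x hx).2.2) hJt hXm)
  | some r =>
    have hr : r ∈ S := by simpa using hoS₀
    obtain ⟨e, p, hpath, hp⟩ := hQp r hr
    refine Or.inr (isMinorOf_IplusP (J := J₀.erase r) (Q := fun s => (Q s : Set V)) (M := X)
      (fun s hs => hconn s (hJS (Finset.mem_of_mem_erase hs)))
      (fun s hs s' hs' => hdisj s (hJS (Finset.mem_of_mem_erase hs)) s'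
        (hJS (Finset.mem_of_mem_erase hs')))
      (fun x hx s hs => (hXmem x hx).2.2 s (Finset.mem_of_mem_erase hs)) hpath
      (fun u hu s hs => ?_) (fun x hx => (hp x).2 (ho2 x r (hXmem x hx).1))
      ((Nat.sub_le_sub_right hJt 1).trans Finset.pred_card_le_card_erase) hXm)
    exact Finset.disjoint_left.1 (hQd r hr s (hJS (Finset.mem_of_mem_erase hs))
      (Finset.ne_of_mem_erase hs).symm) ((hp u).1 hu)

lemma exists_parent_of_isTree {α : Type*} {T : SimpleGraph α} (hT : T.IsTree) (r : α) :
    ∃ par : α → α, par r = r ∧ (∀ z, z ≠ r → T.dist r (par z) < T.dist r z) ∧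
      ∀ a b, T.Adj a b → par a = b ∨ par b = a := by
  have hex : ∀ z, ∃ y, (z = r → y = r) ∧
      (z ≠ r → T.Adj y z ∧ T.dist r z = T.dist r y + 1) := by
    intro z
    by_cases hz : z = r
    · exact ⟨r, fun _ => rfl, fun h => absurd hz h⟩
    obtain ⟨p, hp, hlen⟩ := hT.connected.exists_path_of_dist r z
    have hnil : ¬ p.Nil := fun h => hz h.eq.symm
    refine ⟨p.penultimate, fun h => absurd h hz, fun _ => ⟨p.adj_penultimate hnil, ?_⟩⟩
    have h1 : T.dist r p.penultimate ≤ p.dropLast.length := dist_le _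
    have h2 : T.dist r z ≤ T.dist r p.penultimate + 1 := by
      obtain ⟨p', hp'⟩ := hT.connected.exists_walk_length_eq_dist r p.penultimate
      rw [← hp', ← Walk.length_concat p' (p.adj_penultimate hnil)]
      exact dist_le _
    have h3 : p.dropLast.length + 1 = p.length := p.length_dropLast_add_one hnil
    omega
  choose par h1 h2 using hex
  have key : ∀ a b, T.Adj a b → T.dist r a < T.dist r b → par b = a := by
    intro a b hab hlt
    have hb : b ≠ r := by
      rintro rfl
      simp at hlt
    have hconcat : ∀ y (h : T.Adj y b), T.dist r y < T.dist r b →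
        ∃ p : T.Walk r y, (p.concat h).IsPath := by
      intro y h hlt
      obtain ⟨p, hp, hlen⟩ := hT.connected.exists_path_of_dist r y
      refine ⟨p, hp.concat (fun hmem => ?_) h⟩
      have := (dist_le (p.takeUntil b hmem)).trans (p.length_takeUntil_le_length hmem)
      omega
    obtain ⟨hadj, hd⟩ := h2 b hb
    obtain ⟨p, hp⟩ := hconcat a hab hlt
    obtain ⟨p', hp'⟩ := hconcat (par b) hadj (by omega)
    have heq : p.concat hab = p'.concat hadj :=
      congrArg Subtype.val ((hT.isAcyclic.subsingleton_path r b).elim ⟨_, hp⟩ ⟨_, hp'⟩)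
    have := congrArg Walk.penultimate heq
    simpa using this.symm
  refine ⟨par, h1 r rfl, fun z hz => by have := (h2 z hz).2; omega, fun a b hab => ?_⟩
  rcases lt_or_gt_of_ne (hT.dist_ne_of_adj r hab) with h | h
  · exact Or.inr (key a b hab h)
  · exact Or.inl (key b a hab.symm h)

/-- The sets of vertices that appear only in the bags of a subtree of a rooted tree decomposition
of `G`, together with the child relation of the tree. -/
lemma exists_subtree_family {G : SimpleGraph V} {w : ℕ} (hG : HasTreewidthAtMost G w) :
    ∃ (α : Type) (_ : Fintype α) (r : α) (d : α → ℕ) (child : α → α → Prop)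
      (A β : α → Finset V), A r = Finset.univ ∧
      (∀ x y, child x y → d x < d y) ∧
      (∀ x y, child x y → A y ⊆ A x) ∧
      (∀ x y y', child x y → child x y' → y ≠ y' → Disjoint (A y) (A y')) ∧
      (∀ x, ∀ v ∈ A x, v ∉ β x → ∃ y, child x y ∧ v ∈ A y) ∧
      (∀ x y, child x y → outerBoundary G (A y) ⊆ β x) ∧
      ∀ x, (β x).card ≤ w + 1 := by
  obtain ⟨n, T, β, hT, hedge, hconn, hw⟩ := hG
  obtain ⟨r⟩ := hT.connected.nonempty
  obtain ⟨par, hr, hd, hadj⟩ := exists_parent_of_isTree hT r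
  set desc : Fin n → Fin n → Prop := fun x z => ∃ k, par^[k] z = x with hdesc
  have desc_of_par : ∀ x z, desc x (par z) → desc x z := by
    rintro x z ⟨k, hk⟩
    exact ⟨k + 1, hk⟩
  have eq_or_desc : ∀ x z, desc x z → z = x ∨ desc x (par z) := by
    rintro x z ⟨_ | k, hk⟩
    · exact Or.inl hk
    · exact Or.inr ⟨k, hk⟩
  have desc_par : ∀ y z, desc y z → desc (par y) z := by
    rintro y z ⟨k, rfl⟩
    exact ⟨k + 1, Function.iterate_succ_apply' par k z⟩
  have desc_root : ∀ z, desc r z := by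
    intro z
    induction h : T.dist r z using Nat.strong_induction_on generalizing z with
    | _ k ih =>
      by_cases hz : z = r
      · exact ⟨0, hz⟩
      · exact desc_of_par r z (ih _ (h ▸ hd z hz) _ rfl)
  have par_le : ∀ k z, T.dist r (par^[k] z) ≤ T.dist r z := by
    intro k
    induction k with
    | zero => exact fun z => le_rfl
    | succ k ih =>
      intro z
      refine (ih (par z)).trans ?_
      by_cases hz : z = r
      · rw [hz, hr]
      · exact (hd z hz).le
  have child_lt : ∀ x y, par y = x ∧ y ≠ x → T.dist r x < T.dist r y := by
    rintro x y ⟨rfl, hne⟩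
    refine hd y ?_
    rintro rfl
    exact hne hr.symm
  have exists_child : ∀ x z, desc x z → z ≠ x → ∃ y, (par y = x ∧ y ≠ x) ∧ desc y z := by
    rintro x z ⟨k, hk⟩
    induction k generalizing z with
    | zero => exact fun h => absurd hk h
    | succ k ih =>
      intro hz
      by_cases hpz : par z = x
      · exact ⟨z, ⟨hpz, hz⟩, 0, rfl⟩
      · obtain ⟨y, hy, hyz⟩ := ih (par z) hk hpz
        exact ⟨y, hy, desc_of_par y z hyz⟩
  have child_unique : ∀ x y y' z, par y = x ∧ y ≠ x → par y' = x ∧ y' ≠ x →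
      desc y z → desc y' z → y = y' := by
    have key : ∀ x y y' z k k', par y = x ∧ y ≠ x → par y' = x ∧ y' ≠ x →
        par^[k] z = y → par^[k'] z = y' → k ≤ k' → y = y' := by
      intro x y y' z k k' hy hy' hk hk' hle
      obtain ⟨e, rfl⟩ := Nat.exists_eq_add_of_le hle
      rw [Nat.add_comm, Function.iterate_add_apply, hk] at hk'
      cases e with
      | zero => exact hk'
      | succ e =>
        rw [Function.iterate_succ_apply, hy.1] at hk'
        have h1 := par_le e x
        have h2 := child_lt x y' hy'
        rw [hk'] at h1
        omega
    rintro x y y' z hy hy' ⟨k, hk⟩ ⟨k', hk'⟩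
    rcases le_total k k' with h | h
    · exact key x y y' z k k' hy hy' hk hk' h
    · exact (key x y' y z k' k hy' hy hk' hk h).symm
  have cross : ∀ x v z z', v ∈ β z → desc x z → v ∈ β z' → ¬ desc x z' →
      v ∈ β x ∧ v ∈ β (par x) := by
    intro x v z z' hz hxz hz' hxz'
    obtain ⟨p⟩ := (hconn v).preconnected ⟨z, hz⟩ ⟨z', hz'⟩
    obtain ⟨e, -, h1, h2⟩ := p.exists_boundary_dart {u | desc x u.1} hxz hxz'
    have he : T.Adj e.fst.1 e.snd.1 := e.adj
    simp only [Set.mem_ofPred_eq] at h1 h2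
    rcases hadj _ _ he with h | h
    · rcases eq_or_desc _ _ h1 with h' | h'
      · have h3 : v ∈ β e.fst.1 := e.fst.2
        have h4 : v ∈ β e.snd.1 := e.snd.2
        rw [← h] at h4
        rw [h'] at h3 h4
        exact ⟨h3, h4⟩
      · exact absurd (h ▸ h') h2
    · exact absurd (desc_of_par _ _ (h ▸ h1)) h2
  have hbag : ∀ v, ∃ z, v ∈ β z := fun v => by
    obtain ⟨z⟩ := (hconn v).nonempty
    exact ⟨z.1, z.2⟩
  refine ⟨Fin n, inferInstance, r, T.dist r, fun x y => par y = x ∧ y ≠ x,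
    fun x => Finset.univ.filter fun v => ∀ z, v ∈ β z → desc x z, fun x => (β x).toFinset,
    ?_, child_lt, ?_, ?_, ?_, ?_, ?_⟩
  · ext v
    simp only [Finset.mem_filter, Finset.mem_univ, true_and, iff_true]
    exact fun z _ => desc_root z
  · rintro x y ⟨rfl, -⟩ v hv
    simp only [Finset.mem_filter, Finset.mem_univ, true_and] at hv ⊢
    exact fun z hz => desc_par y z (hv z hz)
  · intro x y y' hy hy' hne
    refine Finset.disjoint_left.2 fun v hv hv' => ?_
    simp only [Finset.mem_filter, Finset.mem_univ, true_and] at hv hv'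
    obtain ⟨z, hz⟩ := hbag v
    exact hne (child_unique x y y' z hy hy' (hv z hz) (hv' z hz))
  · intro x v hv hvx
    simp only [Finset.mem_filter, Finset.mem_univ, true_and, Set.mem_toFinset] at hv hvx ⊢
    obtain ⟨z, hz⟩ := hbag v
    obtain ⟨y, hy, hyz⟩ := exists_child x z (hv z hz) (fun h => hvx (h ▸ hz))
    refine ⟨y, hy, fun z' hz' => ?_⟩
    by_contra h
    exact hvx (hy.1 ▸ (cross y v z z' hz hyz hz' h).2)
  · rintro x y ⟨rfl, -⟩ u hu
    rw [mem_outerBoundary] at hu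
    simp only [Finset.mem_filter, Finset.mem_univ, true_and, Set.mem_toFinset] at hu ⊢
    obtain ⟨hu, a, ha, hau⟩ := hu
    push Not at hu
    obtain ⟨z', hz', h⟩ := hu
    obtain ⟨z, haz, huz⟩ := hedge hau
    exact (cross y u z z' huz (ha z haz) hz' h).2
  · intro x
    rw [← Set.ncard_eq_toFinset_card']
    exact hw x

/-- Many disjoint sets that are not `t`-islands and have their boundaries in a fixed small set
give a `K_{t,m}` minor. -/
lemma isMinorOf_of_disjoint_family {G : SimpleGraph V} {α : Type*} {t m k : ℕ} {I : Finset α}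
    {A : α → Finset V} {D : Finset V} (hne : ∀ y ∈ I, (A y).Nonempty)
    (hdisj : ∀ y ∈ I, ∀ y' ∈ I, y ≠ y' → Disjoint (A y) (A y'))
    (hbd : ∀ y ∈ I, outerBoundary G (A y) ⊆ D) (hD : D.card ≤ k) (hI : 2 ^ k * m ≤ I.card)
    (hm : 1 ≤ m) (hisl : ∀ y ∈ I, ∃ v ∈ A y, t ≤ (outerNeighbors G (A y) v).card) :
    IsMinorOf (completeBipartiteGraph (Fin t) (Fin m)) G := by
  have hk : 0 < 2 ^ k * m := Nat.mul_pos (by positivity) hm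
  obtain ⟨y₀, hy₀⟩ := Finset.card_pos.1 (hk.trans_le hI)
  obtain ⟨v₀, -⟩ := hne y₀ hy₀
  have : ∀ y, ∃ v, y ∈ I → v ∈ A y ∧ t ≤ (outerNeighbors G (A y) v).card := by
    intro y
    by_cases hy : y ∈ I
    · obtain ⟨v, hv⟩ := hisl y hy
      exact ⟨v, fun _ => hv⟩
    · exact ⟨v₀, fun h => absurd h hy⟩
  choose v hv using this
  have hvinj : Set.InjOn v I := by
    intro y hy y' hy' heq
    by_contra hne
    exact Finset.disjoint_left.1 (hdisj y hy y' hy' hne) (hv y hy).1 (heq ▸ (hv y' hy').1)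
  obtain ⟨N, -, hfib⟩ := Finset.exists_le_card_fiber_of_mul_le_card_of_maps_to
    (s := I) (t := D.powerset) (f := fun y => outerNeighbors G (A y) (v y)) (n := m)
    (fun y hy => by
      refine Finset.mem_powerset.2 fun u hu => hbd y hy ?_
      obtain ⟨h1, h2⟩ := mem_outerNeighbors.1 hu
      exact mem_outerBoundary.2 ⟨h1, v y, (hv y hy).1, h2⟩)
    ⟨∅, by simp⟩
    (by
      rw [Finset.card_powerset]
      exact (Nat.mul_le_mul_right m (Nat.pow_le_pow_right (by norm_num) hD)).trans hI)
  set F := I.filter fun y => outerNeighbors G (A y) (v y) = N with hF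
  have hFmem : ∀ y ∈ F, y ∈ I ∧ outerNeighbors G (A y) (v y) = N := fun y hy =>
    Finset.mem_filter.1 hy
  obtain ⟨y₁, hy₁⟩ : F.Nonempty := Finset.card_pos.1 (by omega)
  refine isMinorOf_completeBipartiteGraph (J := N) (Q := fun u => {u}) (M := F.image v)
    (fun u _ => connected_induce_singleton G u)
    (fun u _ u' _ hne => Set.disjoint_singleton.2 hne) (fun x hx u hu => ?_)
    (fun x hx u hu => ?_) ?_ ?_
  · obtain ⟨y, hy, rfl⟩ := Finset.mem_image.1 hx
    obtain ⟨hyI, rfl⟩ := hFmem y hy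
    rintro rfl
    exact (mem_outerNeighbors.1 hu).1 (hv y hyI).1
  · obtain ⟨y, hy, rfl⟩ := Finset.mem_image.1 hx
    obtain ⟨hyI, rfl⟩ := hFmem y hy
    exact ⟨u, rfl, (mem_outerNeighbors.1 hu).2.symm⟩
  · obtain ⟨hyI, rfl⟩ := hFmem y₁ hy₁
    exact (hv y₁ hyI).2
  · rwa [Finset.card_image_of_injOn (hvinj.mono (Finset.coe_subset.2 (Finset.filter_subset _ _)))]

/-- The sizes of the members of a chain of sets with bounded boundaries. -/
def chainSize (m w : ℕ) : ℕ → ℕ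
  | 0 => 0
  | i + 1 => (w + 1) + 2 ^ (w + 1) * m * chainSize m w i

/-- If no small set is an island, then `G` has a `K_{t,m}` minor or a long chain of sets with
bounded boundaries. -/
lemma exists_chain_of_hasTreewidthAtMost {G : SimpleGraph V} {t m w : ℕ} (hm : 1 ≤ m)
    (hG : HasTreewidthAtMost G w)
    (hminor : ¬ IsMinorOf (completeBipartiteGraph (Fin t) (Fin m)) G) (L : ℕ)
    (hisl : ∀ W : Finset V, W.Nonempty → W.card ≤ chainSize m w L →
      ∃ v ∈ W, t ≤ (outerNeighbors G W v).card)
    (hL : chainSize m w L < Fintype.card V) :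
    ∃ c : ℕ → Finset V, (∀ i j, i < j → j ≤ L → c i ⊂ c j) ∧
      ∀ i ≤ L, (c i).card ≤ chainSize m w i ∧ (outerBoundary G (c i)).card ≤ w + 1 := by
  have hmono : Monotone (chainSize m w) := by
    refine monotone_nat_of_le_succ fun i => ?_
    have : 1 ≤ 2 ^ (w + 1) * m := Nat.mul_pos (by positivity) hm
    have := Nat.mul_le_mul_right (chainSize m w i) this
    rw [chainSize]
    omega
  obtain ⟨α, _, r, d, child, A, β, hr, hd, hsub, hdisj, hcov, hbd, hβ⟩ := exists_subtree_family hG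
  have step : ∀ i ≤ L, ∀ x, chainSize m w i < (A x).card → (outerBoundary G (A x)).card ≤ w + 1 →
      ∃ y, A y ⊆ A x ∧ chainSize m w i < (A y).card ∧ (outerBoundary G (A y)).card ≤ w + 1 ∧
        (A y).card ≤ chainSize m w (i + 1) := by
    intro i hi x hx hxb
    obtain ⟨y, hy, hmax⟩ := Finset.exists_max_image
      (Finset.univ.filter fun y => A y ⊆ A x ∧ chainSize m w i < (A y).card ∧
        (outerBoundary G (A y)).card ≤ w + 1) d ⟨x, by simp [hx, hxb]⟩
    simp only [Finset.mem_filter, Finset.mem_univ, true_and] at hy hmax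
    obtain ⟨hyx, hyc, hyb⟩ := hy
    refine ⟨y, hyx, hyc, hyb, ?_⟩
    have hsmall : ∀ z, child y z → (A z).card ≤ chainSize m w i := by
      intro z hz
      by_contra h
      have := hmax z ⟨(hsub y z hz).trans hyx, by omega,
        (Finset.card_le_card (hbd y z hz)).trans (hβ y)⟩
      have := hd y z hz
      omega
    set I := Finset.univ.filter fun z => child y z ∧ (A z).Nonempty with hI
    have hImem : ∀ z, z ∈ I ↔ child y z ∧ (A z).Nonempty := by simp [hI]
    have hIcard : I.card ≤ 2 ^ (w + 1) * m := by
      by_contra! h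
      refine hminor (isMinorOf_of_disjoint_family (I := I) (A := A) (D := β y)
        (fun z hz => ((hImem z).1 hz).2)
        (fun z hz z' hz' => hdisj y z z' ((hImem z).1 hz).1 ((hImem z').1 hz').1)
        (fun z hz => hbd y z ((hImem z).1 hz).1) (hβ y) h.le hm fun z hz => ?_)
      obtain ⟨hz, hne⟩ := (hImem z).1 hz
      exact hisl _ hne ((hsmall z hz).trans (hmono hi))
    have hAy : A y ⊆ β y ∪ I.biUnion A := by
      intro v hv
      by_cases hvy : v ∈ β y
      · exact Finset.mem_union_left _ hvy
      · obtain ⟨z, hz, hvz⟩ := hcov y v hv hvy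
        exact Finset.mem_union_right _
          (Finset.mem_biUnion.2 ⟨z, (hImem z).2 ⟨hz, v, hvz⟩, hvz⟩)
    calc (A y).card ≤ (β y).card + (I.biUnion A).card :=
          (Finset.card_le_card hAy).trans (Finset.card_union_le _ _)
      _ ≤ (w + 1) + I.card * chainSize m w i := Nat.add_le_add (hβ y)
          (Finset.card_biUnion_le_card_mul _ _ _ fun z hz => hsmall z ((hImem z).1 hz).1)
      _ ≤ chainSize m w (i + 1) :=
          Nat.add_le_add_left (Nat.mul_le_mul_right _ hIcard) _
  have build : ∀ l ≤ L, ∀ x, chainSize m w l < (A x).card →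
      (outerBoundary G (A x)).card ≤ w + 1 →
      ∃ c : ℕ → Finset V, (∀ i j, i < j → j ≤ l → c i ⊂ c j) ∧ c l ⊆ A x ∧
        ∀ i ≤ l, (c i).card ≤ chainSize m w i ∧ (outerBoundary G (c i)).card ≤ w + 1 := by
    intro l
    induction l with
    | zero =>
      intro _ x _ _
      refine ⟨fun _ => ∅, fun i j _ _ => by omega, by simp, fun i _ => ⟨by simp, ?_⟩⟩
      have : outerBoundary G ∅ = ∅ := by
        ext u
        simp [mem_outerBoundary]
      simp [this]
    | succ l ih =>
      intro hl x hx hxb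
      obtain ⟨y, hyx, hyc, hyb, hyc'⟩ := step l (by omega) x
        ((hmono (Nat.le_succ l)).trans_lt hx) hxb
      obtain ⟨c, hc, hcy, hci⟩ := ih (by omega) y hyc hyb
      have hss : c l ⊂ A y := by
        refine hcy.ssubset_of_ne fun h => ?_
        have := (hci l le_rfl).1
        rw [h] at this
        omega
      refine ⟨fun i => if i ≤ l then c i else A y, fun i j hij hj => ?_, by simpa using hyx,
        fun i hi => ?_⟩
      · by_cases hjl : j ≤ l
        · simpa [hjl, (hij.le.trans hjl)] using hc i j hij hjl
        · have hil : i ≤ l := by omega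
          simp only [hil, hjl, if_true, if_false]
          rcases hil.eq_or_lt with rfl | h
          · exact hss
          · exact (hc i l h le_rfl).trans hss
      · by_cases hil : i ≤ l
        · simpa [hil] using hci i hil
        · obtain rfl : i = l + 1 := by omega
          simpa using ⟨hyc', hyb⟩
  obtain ⟨c, hc, -, hci⟩ := build L le_rfl r (by rwa [hr, Finset.card_univ]) (by
    have : outerBoundary G (A r) = ∅ := by
      ext u
      simp [mem_outerBoundary, hr]
    simp [this])
  exact ⟨c, hc, hci⟩

/-- The bound on the size of islands. -/
def islandBound (m w : ℕ) : ℕ :=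
  chainSize m w (linkedChainBound (windowCount m w * 3 ^ (w + 2)) (w + 1)) + 1

lemma exists_isIsland_of_not_isMinorOf [Nonempty V] {G : SimpleGraph V} {t m w : ℕ}
    (ht : 1 ≤ t) (hm : 1 ≤ m) (hG : HasTreewidthAtMost G w)
    (h1 : ¬ IsMinorOf (completeBipartiteGraph (Fin t) (Fin m)) G)
    (h2 : ¬ IsMinorOf (IplusP (t - 1) m) G) :
    ∃ S : Set V, IsIsland G t S ∧ S.ncard ≤ islandBound m w := by
  by_contra! h
  have hisl : ∀ W : Finset V, W.Nonempty → W.card ≤ islandBound m w →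
      ∃ v ∈ W, t ≤ (outerNeighbors G W v).card := by
    intro W hW hcard
    by_contra! hW'
    refine absurd (h W ⟨by simpa using hW, fun v hv => ?_⟩) (by simpa using hcard)
    have : G.neighborSet v \ (W : Set V) = (outerNeighbors G W v : Finset V) := by
      ext u
      simp [mem_outerNeighbors, and_comm]
    rw [this, Set.ncard_coe_finset]
    exact hW' v hv
  set M := windowCount m w * 3 ^ (w + 2) with hM
  set L := linkedChainBound M (w + 1) with hL
  have hbound : islandBound m w = chainSize m w L + 1 := rfl
  have hMpos : 0 < M := by
    rw [hM, windowCount]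
    exact Nat.mul_pos (Nat.mul_pos (by positivity) hm) (by positivity)
  have hlt : chainSize m w L < Fintype.card V := by
    by_contra! hle
    obtain ⟨v, -, hv⟩ := hisl Finset.univ Finset.univ_nonempty
      (by rw [Finset.card_univ]; omega)
    have : outerNeighbors G Finset.univ v = ∅ := by
      ext u
      simp [mem_outerNeighbors]
    rw [this, Finset.card_empty] at hv
    omega
  obtain ⟨c, hc, hci⟩ := exists_chain_of_hasTreewidthAtMost hm hG h1 L
    (fun W hW hcard => hisl W hW (by omega)) hlt
  obtain ⟨k, hk, B, hB, hBc, hBk, hBX⟩ := exists_linked_chain G hMpos (w + 1) c hc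
    fun i hi => (hci i hi).2
  rcases exists_minor_of_linked_chain (t := t) hm hk hB hBk hBX (fun W hW hWB => hisl W hW (by
      have : W.card ≤ (c L).card := Finset.card_le_card (hWB.trans hBc)
      have := (hci L le_rfl).1
      omega)) with h | h
  · exact h1 h
  · exact h2 h

lemma IsIsland.lt_ncard_add {G : SimpleGraph V} {t : ℕ} {S : Set V} (hS : IsIsland G t S) {v : V}
    (hv : v ∈ S) {N : Finset V} (hN : ∀ u ∈ N, G.Adj v u) : N.card < S.ncard + t := by
  have hsub : (N : Set V) ⊆ S ∪ (G.neighborSet v \ S) := fun u hu => by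
    by_cases h : u ∈ S
    · exact Or.inl h
    · exact Or.inr ⟨hN u hu, h⟩
  have := (Set.ncard_le_ncard hsub).trans (Set.ncard_union_le _ _)
  rw [Set.ncard_coe_finset] at this
  exact this.trans_lt (Nat.add_lt_add_left (hS.2 v hv) _)

lemma IsIsland.exists_mem_of_le_card {G : SimpleGraph V} {t : ℕ} {S : Set V} (hS : IsIsland G t S)
    {v : V} (hv : v ∈ S) {N : Finset V} (hN : ∀ u ∈ N, G.Adj v u) (ht : t ≤ N.card) :
    ∃ u ∈ N, u ∈ S := by
  by_contra! h
  have hsub : (N : Set V) ⊆ G.neighborSet v \ S := fun u hu => ⟨hN u hu, h u hu⟩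
  have := Set.ncard_le_ncard hsub
  rw [Set.ncard_coe_finset] at this
  have := hS.2 v hv
  omega

lemma IsIsland.preimage_iso {V W : Type*} {G : SimpleGraph V} {H : SimpleGraph W} {t : ℕ}
    {S : Set W} (hS : IsIsland H t S) (φ : G ≃g H) :
    IsIsland G t (φ ⁻¹' S) ∧ (φ ⁻¹' S).ncard = S.ncard := by
  have hcard : ∀ R : Set W, (φ ⁻¹' R).ncard = R.ncard := fun R =>
    Set.ncard_preimage_of_injective_subset_range φ.injective
      (by rw [φ.surjective.range_eq]; exact Set.subset_univ R)
  refine ⟨⟨hS.1.preimage φ.surjective, fun v hv => ?_⟩, hcard S⟩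
  have : G.neighborSet v \ φ ⁻¹' S = φ ⁻¹' (H.neighborSet (φ v) \ S) := by
    ext u
    exact and_congr φ.map_adj_iff.symm Iff.rfl
  rw [this, hcard]
  exact hS.2 _ hv

lemma IsIsland.lt_ncard_add_completeBipartiteGraph {t m : ℕ} {S : Set (Fin t ⊕ Fin m)}
    (hS : IsIsland (completeBipartiteGraph (Fin t) (Fin m)) t S) : m < S.ncard + t := by
  have hl : ∀ i, Sum.inl i ∈ S → m < S.ncard + t := fun i hi => by
    simpa using hS.lt_ncard_add hi (N := Finset.univ.map ⟨Sum.inr, Sum.inr_injective⟩) (by simp)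
  obtain ⟨i | j, hv⟩ := hS.1
  · exact hl i hv
  · obtain ⟨u, hu, huS⟩ := hS.exists_mem_of_le_card hv
      (N := Finset.univ.map ⟨Sum.inl, Sum.inl_injective⟩) (by simp) (by simp)
    obtain ⟨i, -, rfl⟩ := Finset.mem_map.1 hu
    exact hl i huS

lemma IsIsland.lt_ncard_add_IplusP {t m : ℕ} (ht : 1 ≤ t) {S : Set (Fin (t - 1) ⊕ Fin m)}
    (hS : IsIsland (IplusP (t - 1) m) t S) : m < S.ncard + t := by
  have hl : ∀ i, Sum.inl i ∈ S → m < S.ncard + t := fun i hi => by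
    simpa using hS.lt_ncard_add hi (N := Finset.univ.map ⟨Sum.inr, Sum.inr_injective⟩)
      (by simp [IplusP])
  by_cases h : ∃ i, Sum.inl i ∈ S
  · obtain ⟨i, hi⟩ := h
    exact hl i hi
  push Not at h
  have hstep : ∀ j j' : Fin m, (IplusP (t - 1) m).Adj (Sum.inr j) (Sum.inr j') →
      Sum.inr j ∈ S → Sum.inr j' ∈ S := by
    intro j j' hadj hj
    obtain ⟨u, hu, huS⟩ := hS.exists_mem_of_le_card hj
      (N := insert (Sum.inr j') (Finset.univ.map ⟨Sum.inl, Sum.inl_injective⟩))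
      (by
        intro u hu
        rcases Finset.mem_insert.1 hu with rfl | hu
        · exact hadj
        · obtain ⟨i, -, rfl⟩ := Finset.mem_map.1 hu
          simp [IplusP])
      (by
        rw [Finset.card_insert_of_notMem (by simp), Finset.card_map, Finset.card_univ,
          Fintype.card_fin]
        omega)
    rcases Finset.mem_insert.1 hu with rfl | hu
    · exact huS
    · obtain ⟨i, -, rfl⟩ := Finset.mem_map.1 hu
      exact absurd huS (h i)
  have hadj : ∀ j j' : Fin m, (j : ℕ) + 1 = j' →
      (IplusP (t - 1) m).Adj (Sum.inr j) (Sum.inr j') := by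
    intro j j' hjj
    have : j ≠ j' := by
      rintro rfl
      omega
    simp [IplusP, hjj, this]
  obtain ⟨i | j, hj⟩ := hS.1
  · exact absurd hj (h i)
  have hup : ∀ k (hk : j + k < m), Sum.inr ⟨j + k, hk⟩ ∈ S := by
    intro k
    induction k with
    | zero => exact fun _ => hj
    | succ k ih => exact fun hk => hstep _ _ (hadj ⟨j + k, by omega⟩ _ rfl) (ih (by omega))
  have hdown : ∀ (k : ℕ) (hk : k ≤ (j : ℕ)), Sum.inr ⟨j - k, by omega⟩ ∈ S := by
    intro k
    induction k with
    | zero => exact fun _ => hj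
    | succ k ih =>
      exact fun hk => hstep _ _ (hadj ⟨j - (k + 1), by omega⟩ ⟨j - k, by omega⟩
        (by simp only; omega)).symm (ih (by omega))
  have hall : (Finset.univ.map ⟨Sum.inr, Sum.inr_injective⟩ : Finset (Fin (t - 1) ⊕ Fin m)) ≤
      S.toFinset := by
    intro u hu
    obtain ⟨i, -, rfl⟩ := Finset.mem_map.1 hu
    rw [Set.mem_toFinset]
    rcases le_total (i : ℕ) j with hle | hle
    · convert hdown (j - i) (by omega) using 3
      simp only [Function.Embedding.coeFn_mk]
      congr 1
      ext
      simp only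
      omega
    · convert hup (i - j) (by omega) using 3
      simp only [Function.Embedding.coeFn_mk]
      congr 1
      ext
      simp only
      omega
  have := Finset.card_le_card hall
  rw [Finset.card_map, Finset.card_univ, Fintype.card_fin, ← Set.ncard_eq_toFinset_card'] at this
  omega

lemma MemClass.of_isMinorOf {𝒢 : ∀ n : ℕ, SimpleGraph (Fin n) → Prop} (hmc : MinorClosed 𝒢)
    {n a b : ℕ} {G : SimpleGraph (Fin n)} (hG : 𝒢 n G) {H : SimpleGraph (Fin a ⊕ Fin b)}
    (h : IsMinorOf H G) : MemClass 𝒢 H := by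
  obtain ⟨μ, h1, h2, h3, h4⟩ := h
  refine ⟨a + b, H.comap finSumFinEquiv.symm, hmc.2 G _ hG
    ⟨fun w => μ (finSumFinEquiv.symm w), fun w => h1 _, fun w => h2 _,
      fun w w' hne => h3 (finSumFinEquiv.symm.injective.ne hne), fun w w' hadj => h4 hadj⟩,
    ⟨(Iso.comap finSumFinEquiv.symm H).symm⟩⟩

lemma MemClass.exists_isIsland {𝒢 : ∀ n : ℕ, SimpleGraph (Fin n) → Prop} {t C : ℕ}
    (hC : ∀ (n : ℕ) (G : SimpleGraph (Fin n)), 𝒢 n G → 0 < n →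
      ∃ S : Set (Fin n), IsIsland G t S ∧ S.ncard ≤ C) {W : Type*} [Nonempty W]
    {H : SimpleGraph W} (h : MemClass 𝒢 H) : ∃ S : Set W, IsIsland H t S ∧ S.ncard ≤ C := by
  obtain ⟨n, G, hG, ⟨φ⟩⟩ := h
  obtain ⟨S, hS, hcard⟩ := hC n G hG (φ (Classical.arbitrary W)).pos
  obtain ⟨h1, h2⟩ := hS.preimage_iso φ
  exact ⟨_, h1, h2.trans_le hcard⟩

end Islands

/-- for a minor-closed class `𝒢` of bounded treewidth, there is a uniform
bound `C` on the size of some `t`-island in every non-empty member of `𝒢` iff for some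
`m ≥ 1` neither `K_{t,m}` nor `I_{t-1}+P_m` belongs to `𝒢`. -/
theorem stmt4 (𝒢 : ∀ n : ℕ, SimpleGraph (Fin n) → Prop) (hmc : MinorClosed 𝒢)
    (w : ℕ) (htw : ∀ (n : ℕ) (G : SimpleGraph (Fin n)), 𝒢 n G → HasTreewidthAtMost G w)
    (t : ℕ) (ht : 1 ≤ t) :
    (∃ C : ℕ, 1 ≤ C ∧ ∀ (n : ℕ) (G : SimpleGraph (Fin n)), 𝒢 n G → 0 < n →
        ∃ S : Set (Fin n), IsIsland G t S ∧ S.ncard ≤ C) ↔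
    (∃ m : ℕ, 1 ≤ m ∧ ¬ MemClass 𝒢 (completeBipartiteGraph (Fin t) (Fin m)) ∧
        ¬ MemClass 𝒢 (IplusP (t-1) m)) := by
  constructor
  · rintro ⟨C, hC1, hC⟩
    have hpos : 0 < C + t := by omega
    have hne : ∀ k, Nonempty (Fin k ⊕ Fin (C + t)) := fun k => ⟨Sum.inr ⟨0, hpos⟩⟩
    refine ⟨C + t, hpos, fun h => ?_, fun h => ?_⟩
    · have := hne t
      obtain ⟨S, hS, hcard⟩ := h.exists_isIsland hC
      have := hS.lt_ncard_add_completeBipartiteGraph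
      omega
    · have := hne (t - 1)
      obtain ⟨S, hS, hcard⟩ := h.exists_isIsland hC
      have := hS.lt_ncard_add_IplusP ht
      omega
  · rintro ⟨m, hm, h1, h2⟩
    refine ⟨islandBound m w, Nat.le_add_left 1 _, fun n G hG hn => ?_⟩
    have : Nonempty (Fin n) := ⟨⟨0, hn⟩⟩
    exact exists_isIsland_of_not_isMinorOf ht hm (htw n G hG)
      (fun h => h1 (MemClass.of_isMinorOf hmc hG h))
      (fun h => h2 (MemClass.of_isMinorOf hmc hG h))
end
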